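/- arXiv:2305.08798 — 2 statements merged into one kernel-verified Lean document; each statement's English description precedes it below -/
import Mathlib

section
/- Let ℓ≥3 be an integer and {J,K} ∈ P•(ℓ) with 1∈J. For every p ∈ R_{[ℓ]} there exists q ∈ R_{{nd}⊔J} ⊗_ℤ R_{{nd}⊔K} such that D̃⁰_{J,K}·(F(p) − F(F_{J,K}(q))) ∈ I_{[ℓ+1]}; that is, D̃⁰_{J,K}·(Im F) ⊆ D̃⁰_{J,K}·(Im(F∘F_{J,K})) + I_{[ℓ+1]}. -/
open MvPolynomial Finset TensorProduct

noncomputable section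

/-- `[ℓ] = {1, …, ℓ}`. -/
abbrev Iset (n : ℕ) : Finset ℕ := Finset.Icc 1 n

/-! ### The "complex" rings `R_S = R[(D_{J,K})_{{J,K} ∈ P•(S)}]`.
An unordered pair `{J,K}` with `J ⊔ K = S` and `2 ≤ |J| ≤ |S|-2` is represented by
its unique member containing `min S`. -/

/-- Index type for the variables `D_{J,K}`, `{J,K} ∈ P•(S)`: the canonical member
of the pair is the one whose minimum is `min S`. -/
abbrev CxIdx (S : Finset ℕ) : Type :=
  {J : Finset ℕ // J ⊆ S ∧ 2 ≤ J.card ∧ 2 ≤ (S \ J).card ∧ J.min = S.min}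

/-- The polynomial ring `R_S` on the variables `D_{J,K}`, `{J,K} ∈ P•(S)`. -/
abbrev CxRing (R : Type) [CommRing R] (S : Finset ℕ) : Type := MvPolynomial (CxIdx S) R

def cxXv (R : Type) [CommRing R] (S J : Finset ℕ) : CxRing R S :=
  if h : J ⊆ S ∧ 2 ≤ J.card ∧ 2 ≤ (S \ J).card ∧ J.min = S.min then X ⟨J, h⟩ else 0

/-- The variable `D_{J,K}` of `R_S` (equal to `0` if `{J,K} ∉ P•(S)`). -/
def cxD (R : Type) [CommRing R] (S J K : Finset ℕ) : CxRing R S :=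
  if Disjoint J K ∧ J ∪ K = S then (if J.min ≤ K.min then cxXv R S J else cxXv R S K)
  else 0

/-- `{J,K} ⋂̸ {J',K'}`:  `J ⊄ J'`, `J ⊄ K'`, `J' ⊄ J` and `K' ⊄ J`. -/
abbrev NcapCx (J J' K' : Finset ℕ) : Prop :=
  ¬ J ⊆ J' ∧ ¬ J ⊆ K' ∧ ¬ J' ⊆ J ∧ ¬ K' ⊆ J

/-- The element `R^S_{abcd}`. -/
def cxRel (R : Type) [CommRing R] (S : Finset ℕ) (a b c d : ℕ) : CxRing R S :=
  (∑ J ∈ S.powerset,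
    if 2 ≤ J.card ∧ 2 ≤ (S \ J).card ∧ a ∈ J ∧ b ∈ J ∧ c ∈ S \ J ∧ d ∈ S \ J
    then cxD R S J (S \ J) else 0)
  - ∑ J ∈ S.powerset,
    if 2 ≤ J.card ∧ 2 ≤ (S \ J).card ∧ a ∈ J ∧ c ∈ J ∧ b ∈ S \ J ∧ d ∈ S \ J
    then cxD R S J (S \ J) else 0

/-- The ideal `I_S ⊂ R_S`. -/
def cxIdeal (R : Type) [CommRing R] (S : Finset ℕ) : Ideal (CxRing R S) :=
  Ideal.span (
    {x | ∃ J K J' K' : Finset ℕ,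
      (Disjoint J K ∧ J ∪ K = S ∧ 2 ≤ J.card ∧ 2 ≤ K.card) ∧
      (Disjoint J' K' ∧ J' ∪ K' = S ∧ 2 ≤ J'.card ∧ 2 ≤ K'.card) ∧
      NcapCx J J' K' ∧ x = cxD R S J K * cxD R S J' K'} ∪
    {x | ∃ a b c d : ℕ, a ∈ S ∧ b ∈ S ∧ c ∈ S ∧ d ∈ S ∧ a ≠ b ∧ c ≠ d ∧
      x = cxRel R S a b c d})

/-- The homomorphism `F : R_{[ℓ]} → R_{[ℓ+1]}`, `D_{J,K} ↦ D_{J∪{ℓ+1},K} + D_{J,K∪{ℓ+1}}`. -/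
def Fcx (R : Type) [CommRing R] (ℓ : ℕ) : CxRing R (Iset ℓ) →ₐ[R] CxRing R (Iset (ℓ + 1)) :=
  aeval fun i =>
    cxD R (Iset (ℓ + 1)) (i.1 ∪ {ℓ + 1}) (Iset ℓ \ i.1)
    + cxD R (Iset (ℓ + 1)) i.1 ((Iset ℓ \ i.1) ∪ {ℓ + 1})

/-- The homomorphism `F_P : R_{{nd}⊔B} → R_{[ℓ]}`, `D_{J',K'} ↦ D_{P∪(J'-{nd}),K'}` for
`nd ∈ J'`; here `nd = 0`. -/
def FJcx (R : Type) [CommRing R] (ℓ : ℕ) (P B : Finset ℕ) :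
    CxRing R (insert 0 B) →ₐ[R] CxRing R (Iset ℓ) :=
  aeval fun i => cxD R (Iset ℓ) (P ∪ i.1.erase 0) (insert 0 B \ i.1)

/-- The homomorphism `F_{J,K} : R_{{nd}⊔J} ⊗ R_{{nd}⊔K} → R_{[ℓ]}` acting by `F_K` on the
first factor and by `F_J` on the second. -/
def FJKcx (R : Type) [CommRing R] (ℓ : ℕ) (J K : Finset ℕ) :
    TensorProduct R (CxRing R (insert 0 J)) (CxRing R (insert 0 K)) →ₐ[R] CxRing R (Iset ℓ) :=
  Algebra.TensorProduct.productMap (FJcx R ℓ K J) (FJcx R ℓ J K)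

/-- The submodule `A ⊗ I_B + I_A ⊗ B` of `A ⊗_R B`. -/
def mixedSub (R : Type) [CommRing R] {A B : Type} [CommRing A] [CommRing B]
    [Algebra R A] [Algebra R B] (IA : Ideal A) (IB : Ideal B) :
    Submodule R (TensorProduct R A B) :=
  Submodule.span R
    ({x | ∃ p q, q ∈ IB ∧ x = p ⊗ₜ[R] q} ∪ {x | ∃ p q, p ∈ IA ∧ x = p ⊗ₜ[R] q})

/-! ### The "real" rings `R_{0,S}` with variables `ℝE_{J,K}`, `{J,K} ∈ P(S)`, and
`ℝD_{I;J,K}`, `(I,{J,K}) ∈ P̃•(S)`.  The unordered pair `{J,K}` is represented by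
its member whose minimum equals the minimum of `J ∪ K`. -/

abbrev EIdx (S : Finset ℕ) : Type := {J : Finset ℕ // J ⊆ S ∧ J.min = S.min}

abbrev DIdx (S : Finset ℕ) : Type :=
  {p : Finset ℕ × Finset ℕ //
    p.1 ⊆ S ∧ p.2 ⊆ S \ p.1 ∧ 1 ≤ p.1.card ∧ 2 ≤ (S \ p.1).card ∧ p.2.min = (S \ p.1).min}

/-- The polynomial ring `R_{0,S}`. -/
abbrev RRing (R : Type) [CommRing R] (S : Finset ℕ) : Type :=
  MvPolynomial (EIdx S ⊕ DIdx S) R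

def reXe (R : Type) [CommRing R] (S J : Finset ℕ) : RRing R S :=
  if h : J ⊆ S ∧ J.min = S.min then X (Sum.inl ⟨J, h⟩) else 0

/-- The variable `ℝE_{J,K}` of `R_{0,S}` (equal to `0` if `{J,K} ∉ P(S)`). -/
def reE (R : Type) [CommRing R] (S J K : Finset ℕ) : RRing R S :=
  if Disjoint J K ∧ J ∪ K = S then (if J.min ≤ K.min then reXe R S J else reXe R S K)
  else 0

def reXd (R : Type) [CommRing R] (S I J : Finset ℕ) : RRing R S :=
  if h : I ⊆ S ∧ J ⊆ S \ I ∧ 1 ≤ I.card ∧ 2 ≤ (S \ I).card ∧ J.min = (S \ I).min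
  then X (Sum.inr ⟨(I, J), h⟩) else 0

/-- The variable `ℝD_{I;J,K}` of `R_{0,S}` (equal to `0` if `(I,{J,K}) ∉ P̃•(S)`). -/
def reD (R : Type) [CommRing R] (S I J K : Finset ℕ) : RRing R S :=
  if Disjoint I (J ∪ K) ∧ Disjoint J K ∧ I ∪ (J ∪ K) = S then
    (if J.min ≤ K.min then reXd R S I J else reXd R S I K)
  else 0

/-- The sign `ε_{J,K}`: `1` if `min (J ∪ K) ∈ J` and `-1` otherwise. -/
def epsm (J K : Finset ℕ) : ℤ := if J.min ≤ K.min then 1 else -1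

/-- `{J,K} ⪯ {J',K'}`. -/
abbrev preceq (J K J' K' : Finset ℕ) : Prop := (J ⊆ J' ∧ K ⊆ K') ∨ (J ⊆ K' ∧ K ⊆ J')

/-- `{J,K} ∈ P(S)`. -/
abbrev validE (S J K : Finset ℕ) : Prop := Disjoint J K ∧ J ∪ K = S

/-- `(I,{J,K}) ∈ P̃•(S)`. -/
abbrev validD (S I J K : Finset ℕ) : Prop :=
  Disjoint I (J ∪ K) ∧ Disjoint J K ∧ I ∪ (J ∪ K) = S ∧ 1 ≤ I.card ∧ 2 ≤ (J ∪ K).card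

/-- The element `E^S_{abc}`. -/
def relE (R : Type) [CommRing R] (S : Finset ℕ) (a b c : ℕ) : RRing R S :=
  (∑ I ∈ S.powerset, ∑ J ∈ (S \ I).powerset,
    if 1 ≤ I.card ∧ 2 ≤ (S \ I).card ∧ a ∈ J ∧ b ∈ J ∧ c ∈ I
    then epsm J ((S \ I) \ J) • reD R S I J ((S \ I) \ J) else 0)
  - (∑ I ∈ S.powerset, ∑ J ∈ (S \ I).powerset,
    if 1 ≤ I.card ∧ 2 ≤ (S \ I).card ∧ a ∈ J ∧ c ∈ J ∧ b ∈ I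
    then epsm J ((S \ I) \ J) • reD R S I J ((S \ I) \ J) else 0)
  - ∑ I ∈ S.powerset, ∑ J ∈ (S \ I).powerset,
    if 1 ≤ I.card ∧ 2 ≤ (S \ I).card ∧ a ∈ I ∧ b ∈ J ∧ c ∈ (S \ I) \ J
    then epsm J ((S \ I) \ J) • reD R S I J ((S \ I) \ J) else 0

/-- The element `Σ_{{J,K} ∈ P(S)} ℝE_{J,K}`. -/
def relEsum (R : Type) [CommRing R] (S : Finset ℕ) : RRing R S :=
  ∑ J ∈ S.powerset.filter (fun J => J.min = S.min), reE R S J (S \ J)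

/-- The ideal `I_{0,S} ⊂ R_{0,S}`. -/
def reIdeal (R : Type) [CommRing R] (S : Finset ℕ) : Ideal (RRing R S) :=
  Ideal.span (
    {x | ∃ J K J' K' : Finset ℕ, validE S J K ∧ validE S J' K' ∧
      x = reE R S J K * reE R S J' K'} ∪
    {x | ∃ J K I' J' K' : Finset ℕ, validE S J K ∧ validD S I' J' K' ∧
      ¬ preceq J' K' J K ∧ x = reE R S J K * reD R S I' J' K'} ∪
    {x | ∃ I J K I' J' K' : Finset ℕ, validD S I J K ∧ validD S I' J' K' ∧
      ¬ preceq J K J' K' ∧ ¬ preceq J' K' J K ∧ ¬ J ∪ K ⊆ I' ∧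
      x = reD R S I J K * reD R S I' J' K'} ∪
    {relEsum R S} ∪
    {x | ∃ a b c : ℕ, a ∈ S ∧ b ∈ S ∧ c ∈ S ∧ a ≠ b ∧ a ≠ c ∧ b ≠ c ∧
      x = relE R S a b c})

/-- The element `G_{abc}` of Remark `RcM04rel_e2b2`. -/
def relG (R : Type) [CommRing R] (S : Finset ℕ) (a b c : ℕ) : RRing R S :=
  (∑ I ∈ S.powerset, ∑ J ∈ (S \ I).powerset,
    if 1 ≤ I.card ∧ 2 ≤ (S \ I).card ∧ a ∈ J ∧ b ∉ I ∧ c ∈ I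
    then epsm J ((S \ I) \ J) • reD R S I J ((S \ I) \ J) else 0)
  - ∑ I ∈ S.powerset, ∑ J ∈ (S \ I).powerset,
    if 1 ≤ I.card ∧ 2 ≤ (S \ I).card ∧ a ∈ J ∧ b ∈ I ∧ c ∉ I
    then epsm J ((S \ I) \ J) • reD R S I J ((S \ I) \ J) else 0

/-- The homomorphism `F : R_{0,[ℓ]} → R_{0,[ℓ+1]}`. -/
def Fre (R : Type) [CommRing R] (ℓ : ℕ) : RRing R (Iset ℓ) →ₐ[R] RRing R (Iset (ℓ + 1)) :=
  aeval fun ix =>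
    match ix with
    | Sum.inl e =>
        reE R (Iset (ℓ + 1)) (e.1 ∪ {ℓ + 1}) (Iset ℓ \ e.1)
        + reE R (Iset (ℓ + 1)) e.1 ((Iset ℓ \ e.1) ∪ {ℓ + 1})
    | Sum.inr d =>
        reD R (Iset (ℓ + 1)) (d.1.1 ∪ {ℓ + 1}) d.1.2 ((Iset ℓ \ d.1.1) \ d.1.2)
        + reD R (Iset (ℓ + 1)) d.1.1 (d.1.2 ∪ {ℓ + 1}) ((Iset ℓ \ d.1.1) \ d.1.2)
        + reD R (Iset (ℓ + 1)) d.1.1 d.1.2 (((Iset ℓ \ d.1.1) \ d.1.2) ∪ {ℓ + 1})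

/-- `ℝẼ⁰_{J,K} = ℝD_{{ℓ+1};J,K} ∈ R_{0,[ℓ+1]}`. -/
def reEt0 (R : Type) [CommRing R] (ℓ : ℕ) (J K : Finset ℕ) : RRing R (Iset (ℓ + 1)) :=
  reD R (Iset (ℓ + 1)) {ℓ + 1} J K

/-- `ℝẼ⁻_{J,K} = ℝE_{J,K∪{ℓ+1}} ∈ R_{0,[ℓ+1]}`. -/
def reEtm (R : Type) [CommRing R] (ℓ : ℕ) (J K : Finset ℕ) : RRing R (Iset (ℓ + 1)) :=
  reE R (Iset (ℓ + 1)) J (K ∪ {ℓ + 1})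

/-- `ℝD̃⁰_{I;J,K} ∈ R_{0,[ℓ+1]}` (for `(I,{J,K})` written with `min (J∪K) ∈ J`). -/
def reDt0 (R : Type) [CommRing R] (ℓ : ℕ) (I J K : Finset ℕ) : RRing R (Iset (ℓ + 1)) :=
  if 1 ∈ I then reD R (Iset (ℓ + 1)) I (J ∪ {ℓ + 1}) K
  else reD R (Iset (ℓ + 1)) (I ∪ {ℓ + 1}) J K

/-- `ℝD̃⁻_{I;J,K} = ℝD_{I;J,K∪{ℓ+1}} ∈ R_{0,[ℓ+1]}`. -/
def reDtm (R : Type) [CommRing R] (ℓ : ℕ) (I J K : Finset ℕ) : RRing R (Iset (ℓ + 1)) :=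
  reD R (Iset (ℓ + 1)) I J (K ∪ {ℓ + 1})

/-- The homomorphism `F_{J,K} : R^{cx}_{{nd}⊔[ℓ]} → R_{0,[ℓ]}`,
`D_{J',K'} ↦ (-1)^{|K|} ε_{J∩K',K∩K'} ℝD_{J'-{nd};J∩K',K∩K'}` for `nd ∈ J'`; here `nd = 0`. -/
def FJKre (R : Type) [CommRing R] (ℓ : ℕ) (J K : Finset ℕ) :
    CxRing R (insert 0 (Iset ℓ)) →ₐ[R] RRing R (Iset ℓ) :=
  aeval fun i =>
    ((-1 : ℤ) ^ K.card *
        epsm (J ∩ (insert 0 (Iset ℓ) \ i.1)) (K ∩ (insert 0 (Iset ℓ) \ i.1))) •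
      reD R (Iset ℓ) (i.1.erase 0)
        (J ∩ (insert 0 (Iset ℓ) \ i.1)) (K ∩ (insert 0 (Iset ℓ) \ i.1))

/-- The homomorphism `F²_{I;J,K} : R^{cx}_{{nd}⊔(J∪K)} → R_{0,[ℓ]}`,
`D_{J',K'} ↦ (-1)^{|K|} ε_{J∩K',K∩K'} ℝD_{I∪(J'-{nd});J∩K',K∩K'}` for `nd ∈ J'`;
here `nd = 0`. -/
def F2IJK (R : Type) [CommRing R] (ℓ : ℕ) (I J K : Finset ℕ) :
    CxRing R (insert 0 (J ∪ K)) →ₐ[R] RRing R (Iset ℓ) :=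
  aeval fun i =>
    ((-1 : ℤ) ^ K.card *
        epsm (J ∩ (insert 0 (J ∪ K) \ i.1)) (K ∩ (insert 0 (J ∪ K) \ i.1))) •
      reD R (Iset ℓ) (I ∪ i.1.erase 0)
        (J ∩ (insert 0 (J ∪ K) \ i.1)) (K ∩ (insert 0 (J ∪ K) \ i.1))

/-- `nd` for `{nd} ⊔ I`, identified with `min (ℤ⁺ - I)`. -/
def ndOf (I : Finset ℕ) : ℕ := sInf {n : ℕ | 0 < n ∧ n ∉ I}

/-- The homomorphism `F¹_{I;J,K} : R_{0,{nd}⊔I} → R_{0,[ℓ]}` with `nd = min (ℤ⁺ - I)`. -/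
def F1IJK (R : Type) [CommRing R] (ℓ : ℕ) (I J K : Finset ℕ) :
    RRing R (insert (ndOf I) I) →ₐ[R] RRing R (Iset ℓ) :=
  aeval fun ix =>
    match ix with
    | Sum.inl e =>
        if ndOf I ∈ e.1 then
          reE R (Iset ℓ) (J ∪ e.1.erase (ndOf I)) (K ∪ (insert (ndOf I) I \ e.1))
        else
          reE R (Iset ℓ) (J ∪ (insert (ndOf I) I \ e.1).erase (ndOf I)) (K ∪ e.1)
    | Sum.inr d =>
        if ndOf I ∈ d.1.1 then
          reD R (Iset ℓ) (d.1.1.erase (ndOf I) ∪ J ∪ K) d.1.2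
            ((insert (ndOf I) I \ d.1.1) \ d.1.2)
        else if ndOf I ∈ d.1.2 then
          reD R (Iset ℓ) d.1.1 (J ∪ d.1.2.erase (ndOf I))
            (K ∪ ((insert (ndOf I) I \ d.1.1) \ d.1.2))
        else
          reD R (Iset ℓ) d.1.1
            (J ∪ ((insert (ndOf I) I \ d.1.1) \ d.1.2).erase (ndOf I)) (K ∪ d.1.2)

/-- The homomorphism `F_{I;J,K} : R_{0,{nd}⊔I} ⊗ R^{cx}_{{nd}⊔(J∪K)} → R_{0,[ℓ]}`
induced by `F¹_{I;J,K}` and `F²_{I;J,K}`. -/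
def FIJK (R : Type) [CommRing R] (ℓ : ℕ) (I J K : Finset ℕ) :
    TensorProduct R (RRing R (insert (ndOf I) I)) (CxRing R (insert 0 (J ∪ K))) →ₐ[R]
      RRing R (Iset ℓ) :=
  Algebra.TensorProduct.productMap (F1IJK R ℓ I J K) (F2IJK R ℓ I J K)

theorem cxD_comm (S J K : Finset ℕ) : cxD ℤ S J K = cxD ℤ S K J := by
  unfold cxD
  by_cases h : Disjoint J K ∧ J ∪ K = S
  · have h' : Disjoint K J ∧ K ∪ J = S := ⟨h.1.symm, by rw [union_comm]; exact h.2⟩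
    rw [if_pos h, if_pos h']
    rcases lt_trichotomy J.min K.min with hlt | heq | hgt
    · rw [if_pos hlt.le, if_neg (not_le.mpr hlt)]
    · have : J = K := by
        rcases J.eq_empty_or_nonempty with rfl | hne
        · symm
          rw [Finset.min_empty] at heq
          exact Finset.min_eq_top.mp heq.symm
        · exfalso
          obtain ⟨m, hm⟩ := Finset.min_of_nonempty hne
          exact Finset.disjoint_left.mp h.1 (Finset.mem_of_min hm)
            (Finset.mem_of_min (heq ▸ hm))
      subst this; rfl
    · rw [if_neg (not_le.mpr hgt), if_pos hgt.le]
  · have h' : ¬ (Disjoint K J ∧ K ∪ J = S) := fun h' =>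
      h ⟨h'.1.symm, by rw [union_comm]; exact h'.2⟩
    rw [if_neg h, if_neg h']

theorem min_union_left {J K : Finset ℕ} (h : J.min ≤ K.min) : J.min = (J ∪ K).min := by
  rw [Finset.min_union]; exact (min_eq_left h).symm

/-- A variable, written through its canonical member. -/
theorem cxD_eq_X (S J K : Finset ℕ) (hd : Disjoint J K) (hu : J ∪ K = S)
    (hJ : 2 ≤ J.card) (hK : 2 ≤ K.card) (hm : J.min ≤ K.min) :
    ∃ h : J ⊆ S ∧ 2 ≤ J.card ∧ 2 ≤ (S \ J).card ∧ J.min = S.min,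
      cxD ℤ S J K = X ⟨J, h⟩ := by
  have hsd : S \ J = K := by
    rw [← hu, Finset.union_sdiff_left, Finset.sdiff_eq_self_of_disjoint hd.symm]
  have h : J ⊆ S ∧ 2 ≤ J.card ∧ 2 ≤ (S \ J).card ∧ J.min = S.min :=
    ⟨hu ▸ Finset.subset_union_left, hJ, hsd ▸ hK, hu ▸ min_union_left hm⟩
  refine ⟨h, ?_⟩
  unfold cxD cxXv
  rw [if_pos ⟨hd, hu⟩, if_pos hm, dif_pos h]

theorem X_eq_cxD (S : Finset ℕ) (i : CxIdx S) :
    (X i : CxRing ℤ S) = cxD ℤ S i.1 (S \ i.1) := by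
  obtain ⟨J, h⟩ := i
  obtain ⟨h', e⟩ := cxD_eq_X S J (S \ J) Finset.disjoint_sdiff
    (Finset.union_sdiff_of_subset h.1) h.2.1 h.2.2.1
    (by rw [h.2.2.2]; exact Finset.min_mono Finset.sdiff_subset)
  exact e.symm

theorem Fcx_cxD (ℓ : ℕ) (J K : Finset ℕ) (hd : Disjoint J K) (hu : J ∪ K = Iset ℓ)
    (hJ : 2 ≤ J.card) (hK : 2 ≤ K.card) :
    Fcx ℤ ℓ (cxD ℤ (Iset ℓ) J K) =
      cxD ℤ (Iset (ℓ + 1)) (J ∪ {ℓ + 1}) K + cxD ℤ (Iset (ℓ + 1)) J (K ∪ {ℓ + 1}) := by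
  have key : ∀ J K : Finset ℕ, Disjoint J K → J ∪ K = Iset ℓ → 2 ≤ J.card → 2 ≤ K.card →
      J.min ≤ K.min → Fcx ℤ ℓ (cxD ℤ (Iset ℓ) J K) =
      cxD ℤ (Iset (ℓ + 1)) (J ∪ {ℓ + 1}) K + cxD ℤ (Iset (ℓ + 1)) J (K ∪ {ℓ + 1}) := by
    intro J K hd hu hJ hK hm
    obtain ⟨h, e⟩ := cxD_eq_X (Iset ℓ) J K hd hu hJ hK hm
    have hsd : Iset ℓ \ J = K := by
      rw [← hu, Finset.union_sdiff_left, Finset.sdiff_eq_self_of_disjoint hd.symm]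
    rw [e]
    unfold Fcx
    rw [aeval_X, hsd]
  rcases le_total J.min K.min with hm | hm
  · exact key J K hd hu hJ hK hm
  · rw [cxD_comm, key K J hd.symm (by rw [union_comm]; exact hu) hK hJ hm,
      cxD_comm _ K, cxD_comm _ (K ∪ _)]
    exact add_comm _ _

/-- One of the two sums in `R^S_{abcd}`. -/
def halfRel (S : Finset ℕ) (a b c d : ℕ) : CxRing ℤ S :=
  ∑ J ∈ S.powerset,
    if 2 ≤ J.card ∧ 2 ≤ (S \ J).card ∧ a ∈ J ∧ b ∈ J ∧ c ∈ S \ J ∧ d ∈ S \ J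
    then cxD ℤ S J (S \ J) else 0

theorem two_le_card {s : Finset ℕ} {a b : ℕ} (h : a ≠ b) (ha : a ∈ s) (hb : b ∈ s) :
    2 ≤ s.card := Finset.one_lt_card.mpr ⟨a, ha, b, hb, h⟩

theorem Fcx_halfRel (ℓ : ℕ) (a b c d : ℕ) (ha : a ∈ Iset ℓ) (hb : b ∈ Iset ℓ)
    (hc : c ∈ Iset ℓ) (hd : d ∈ Iset ℓ) (hab : a ≠ b) (hcd : c ≠ d) :
    Fcx ℤ ℓ (halfRel (Iset ℓ) a b c d) = halfRel (Iset (ℓ + 1)) a b c d := by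
  have hS : Iset (ℓ + 1) = insert (ℓ + 1) (Iset ℓ) := by
    ext x; simp only [Iset, Finset.mem_Icc, Finset.mem_insert]; omega
  have hn : ℓ + 1 ∉ Iset ℓ := by simp [Iset]
  have ha' : a ≠ ℓ + 1 := fun h => hn (h ▸ ha)
  have hb' : b ≠ ℓ + 1 := fun h => hn (h ▸ hb)
  have hc' : c ≠ ℓ + 1 := fun h => hn (h ▸ hc)
  have hd' : d ≠ ℓ + 1 := fun h => hn (h ▸ hd)
  have e : halfRel (Iset (ℓ + 1)) a b c d = ∑ J ∈ (insert (ℓ + 1) (Iset ℓ)).powerset,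
    if 2 ≤ J.card ∧ 2 ≤ (Iset (ℓ + 1) \ J).card ∧ a ∈ J ∧ b ∈ J ∧
      c ∈ Iset (ℓ + 1) \ J ∧ d ∈ Iset (ℓ + 1) \ J
    then cxD ℤ (Iset (ℓ + 1)) J (Iset (ℓ + 1) \ J) else 0 := by
    rw [← hS]; rfl
  rw [e, Finset.sum_powerset_insert hn, ← Finset.sum_add_distrib]
  unfold halfRel
  rw [map_sum]
  refine Finset.sum_congr rfl fun J hJ => ?_
  rw [Finset.mem_powerset] at hJ
  have hnJ : ℓ + 1 ∉ J := fun h => hn (hJ h)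
  have e1 : Iset (ℓ + 1) \ J = (Iset ℓ \ J) ∪ {ℓ + 1} := by
    rw [hS]; ext x; simp only [mem_sdiff, mem_insert, mem_union, mem_singleton]
    constructor
    · tauto
    · rintro (h | rfl) <;> tauto
  have e2 : Iset (ℓ + 1) \ insert (ℓ + 1) J = Iset ℓ \ J := by
    rw [hS]; ext x; simp only [mem_sdiff, mem_insert]
    constructor
    · tauto
    · rintro ⟨h, h2⟩
      have : x ≠ ℓ + 1 := fun h' => hn (h' ▸ h)
      tauto
  by_cases h : a ∈ J ∧ b ∈ J ∧ c ∈ Iset ℓ \ J ∧ d ∈ Iset ℓ \ J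
  · obtain ⟨h1, h2, h3, h4⟩ := h
    have c1 := two_le_card hab h1 h2
    have c2 := two_le_card hcd h3 h4
    have h3' : c ∈ Iset (ℓ + 1) \ J := by rw [e1]; exact mem_union_left _ h3
    have h4' : d ∈ Iset (ℓ + 1) \ J := by rw [e1]; exact mem_union_left _ h4
    rw [if_pos ⟨c1, c2, h1, h2, h3, h4⟩,
      if_pos ⟨c1, two_le_card hcd h3' h4', h1, h2, h3', h4'⟩, e2,
      if_pos ⟨two_le_card hab (mem_insert_of_mem h1) (mem_insert_of_mem h2), c2,
        mem_insert_of_mem h1, mem_insert_of_mem h2, h3, h4⟩,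
      Fcx_cxD ℓ J _ Finset.disjoint_sdiff (Finset.union_sdiff_of_subset hJ) c1 c2, e1,
      union_comm J, ← Finset.insert_eq]
    exact add_comm _ _
  · rw [if_neg (fun h' => h h'.2.2), if_neg, if_neg, map_zero, add_zero]
    · rw [e2]; rintro ⟨-, -, h1, h2, h3⟩
      exact h ⟨(mem_insert.mp h1).resolve_left ha', (mem_insert.mp h2).resolve_left hb', h3⟩
    · rw [e1]; rintro ⟨-, -, h1, h2, h3, h4⟩
      simp only [mem_union, mem_singleton, hc', hd', or_false] at h3 h4
      exact h ⟨h1, h2, h3, h4⟩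

theorem Fcx_rel_mem (ℓ : ℕ) (a b c d : ℕ) (ha : a ∈ Iset ℓ) (hb : b ∈ Iset ℓ)
    (hc : c ∈ Iset ℓ) (hd : d ∈ Iset ℓ) (hab : a ≠ b) (hcd : c ≠ d) (hac : a ≠ c)
    (hbd : b ≠ d) :
    Fcx ℤ ℓ (halfRel (Iset ℓ) a b c d - halfRel (Iset ℓ) a c b d) ∈
      cxIdeal ℤ (Iset (ℓ + 1)) := by
  rw [map_sub, Fcx_halfRel ℓ a b c d ha hb hc hd hab hcd,
    Fcx_halfRel ℓ a c b d ha hc hb hd hac hbd]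
  have hs : Iset ℓ ⊆ Iset (ℓ + 1) := Finset.Icc_subset_Icc_right (Nat.le_succ _)
  exact Ideal.subset_span (Or.inr ⟨a, b, c, d, hs ha, hs hb, hs hc, hs hd, hab, hcd, rfl⟩)

/-- Nested variables lie in the image of `F_P`. -/
theorem mem_range_FJcx (ℓ : ℕ) (P B T : Finset ℕ) (hd : Disjoint P B) (hu : P ∪ B = Iset ℓ)
    (hT : T ⊆ B) (hne : T ≠ B) (hc : 2 ≤ T.card) :
    cxD ℤ (Iset ℓ) (Iset ℓ \ T) T ∈ (FJcx ℤ ℓ P B).range := by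
  have h0 : (0 : ℕ) ∉ Iset ℓ := by simp [Iset]
  have h0B : 0 ∉ B := fun h => h0 (hu ▸ mem_union_right _ h)
  have h0T : 0 ∉ T := fun h => h0B (hT h)
  obtain ⟨x, hxB, hxT⟩ := Finset.exists_of_ssubset (Finset.ssubset_iff_subset_ne.mpr ⟨hT, hne⟩)
  have hTs : T ⊆ insert 0 B := hT.trans (Finset.subset_insert _ _)
  have h0m : 0 ∈ insert 0 B \ T := mem_sdiff.mpr ⟨mem_insert_self _ _, h0T⟩
  have hss : insert 0 B \ (insert 0 B \ T) = T := Finset.sdiff_sdiff_eq_self hTs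
  have hmin : ∀ s : Finset ℕ, 0 ∈ s → s.min = ((0 : ℕ) : WithTop ℕ) := fun s hs =>
    le_antisymm (Finset.min_le hs) (Finset.le_min fun a _ => WithTop.coe_le_coe.mpr (Nat.zero_le a))
  have hi : (insert 0 B \ T) ⊆ insert 0 B ∧ 2 ≤ (insert 0 B \ T).card ∧
      2 ≤ (insert 0 B \ (insert 0 B \ T)).card ∧
      (insert 0 B \ T).min = (insert 0 B).min := by
    refine ⟨sdiff_subset, ?_, by rw [hss]; exact hc, ?_⟩
    · refine two_le_card (a := 0) (b := x) ?_ h0m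
        (mem_sdiff.mpr ⟨mem_insert_of_mem hxB, hxT⟩)
      rintro rfl; exact h0B hxB
    · rw [hmin _ h0m, hmin _ (mem_insert_self _ _)]
  refine ⟨X ⟨insert 0 B \ T, hi⟩, ?_⟩
  have he : P ∪ (insert 0 B \ T).erase 0 = Iset ℓ \ T := by
    rw [← hu]; ext y
    simp only [mem_union, mem_erase, mem_sdiff, mem_insert]
    have : y ∈ P → y ∉ T := fun h1 h2 => Finset.disjoint_left.mp hd h1 (hT h2)
    have : y ∈ B → y ≠ 0 := fun h h' => h0B (h' ▸ h)
    tauto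
  change FJcx ℤ ℓ P B (X _) = _
  unfold FJcx
  rw [aeval_X, hss, he]

theorem range_left (ℓ : ℕ) (J K : Finset ℕ) (x : CxRing ℤ (Iset ℓ))
    (h : x ∈ (FJcx ℤ ℓ K J).range) : x ∈ (FJKcx ℤ ℓ J K).range := by
  obtain ⟨y, rfl⟩ := h
  exact ⟨y ⊗ₜ 1, by simp [FJKcx]⟩

theorem range_right (ℓ : ℕ) (J K : Finset ℕ) (x : CxRing ℤ (Iset ℓ))
    (h : x ∈ (FJcx ℤ ℓ J K).range) : x ∈ (FJKcx ℤ ℓ J K).range := by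
  obtain ⟨y, rfl⟩ := h
  exact ⟨1 ⊗ₜ y, by simp [FJKcx]⟩

/-- The annihilator of `D̃⁰_{J,K}` modulo `I_{[ℓ+1]}`. -/
def annI (ℓ : ℕ) (J K : Finset ℕ) : Ideal (CxRing ℤ (Iset (ℓ + 1))) :=
  Submodule.comap (LinearMap.mulLeft (CxRing ℤ (Iset (ℓ + 1)))
    (cxD ℤ (Iset (ℓ + 1)) J (K ∪ {ℓ + 1}))) (cxIdeal ℤ (Iset (ℓ + 1)))

theorem mem_annI (ℓ : ℕ) (J K : Finset ℕ) (x : CxRing ℤ (Iset (ℓ + 1))) :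
    x ∈ annI ℓ J K ↔
      cxD ℤ (Iset (ℓ + 1)) J (K ∪ {ℓ + 1}) * x ∈ cxIdeal ℤ (Iset (ℓ + 1)) := Iff.rfl

/-- `F` followed by the quotient by `annI`. -/
def phi (ℓ : ℕ) (J K : Finset ℕ) :
    CxRing ℤ (Iset ℓ) →ₐ[ℤ] (CxRing ℤ (Iset (ℓ + 1)) ⧸ annI ℓ J K) :=
  (Ideal.Quotient.mkₐ ℤ (annI ℓ J K)).comp (Fcx ℤ ℓ)

/-- The subalgebra of the `p` for which the claim holds. -/
def goodSub (ℓ : ℕ) (J K : Finset ℕ) : Subalgebra ℤ (CxRing ℤ (Iset ℓ)) :=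
  (((phi ℓ J K).comp (FJKcx ℤ ℓ J K)).range).comap (phi ℓ J K)

theorem good_of_range (ℓ : ℕ) (J K : Finset ℕ) (x : CxRing ℤ (Iset ℓ))
    (h : x ∈ (FJKcx ℤ ℓ J K).range) : x ∈ goodSub ℓ J K := by
  obtain ⟨y, rfl⟩ := h
  exact ⟨y, rfl⟩

theorem good_of_ann (ℓ : ℕ) (J K : Finset ℕ) (x : CxRing ℤ (Iset ℓ))
    (h : Fcx ℤ ℓ x ∈ annI ℓ J K) : x ∈ goodSub ℓ J K := by
  refine ⟨0, ?_⟩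
  have : phi ℓ J K x = 0 := Ideal.Quotient.eq_zero_iff_mem.mpr h
  simp [this]

theorem good_cross (ℓ : ℕ) (J K : Finset ℕ)
    (hdisj : Disjoint J K) (hun : J ∪ K = Iset ℓ) (hJ : 2 ≤ J.card) (hK : 2 ≤ K.card)
    (J' K' : Finset ℕ) (hd : Disjoint J' K') (hu : J' ∪ K' = Iset ℓ)
    (hJ' : 2 ≤ J'.card) (hK' : 2 ≤ K'.card) (hx : NcapCx J J' K') :
    cxD ℤ (Iset ℓ) J' K' ∈ goodSub ℓ J K := by
  have hS : Iset (ℓ + 1) = Iset ℓ ∪ {ℓ + 1} := by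
    ext x; simp only [Iset, Finset.mem_Icc, Finset.mem_union, mem_singleton]; omega
  have hn : ℓ + 1 ∉ Iset ℓ := by simp [Iset]
  have hnJ : ℓ + 1 ∉ J := fun h => hn (hun ▸ mem_union_left _ h)
  have hnJ' : ℓ + 1 ∉ J' := fun h => hn (hu ▸ mem_union_left _ h)
  have hnK' : ℓ + 1 ∉ K' := fun h => hn (hu ▸ mem_union_right _ h)
  have hsub : ∀ T, J ⊆ T ∪ {ℓ + 1} → J ⊆ T := by
    intro T h x hxJ
    rcases mem_union.mp (h hxJ) with h | h
    · exact h
    · rw [mem_singleton] at h; exact absurd (h ▸ hxJ) hnJ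
  have hcard : ∀ T : Finset ℕ, 2 ≤ T.card → 2 ≤ (T ∪ {ℓ + 1}).card := fun T h =>
    h.trans (card_le_card subset_union_left)
  have hJK : Disjoint J (K ∪ {ℓ + 1}) ∧ J ∪ (K ∪ {ℓ + 1}) = Iset (ℓ + 1) ∧
      2 ≤ J.card ∧ 2 ≤ (K ∪ {ℓ + 1}).card :=
    ⟨disjoint_union_right.mpr ⟨hdisj, disjoint_singleton_right.mpr hnJ⟩,
      by rw [← union_assoc, hun, hS], hJ, hcard _ hK⟩
  obtain ⟨x1, x2, x3, x4⟩ := hx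
  apply good_of_ann
  rw [mem_annI, Fcx_cxD ℓ J' K' hd hu hJ' hK', mul_add]
  refine Ideal.add_mem _ (Ideal.subset_span (Or.inl ⟨J, K ∪ {ℓ + 1}, J' ∪ {ℓ + 1}, K', hJK,
      ⟨?_, ?_, hcard _ hJ', hK'⟩, ⟨?_, x2, ?_, x4⟩, rfl⟩))
    (Ideal.subset_span (Or.inl ⟨J, K ∪ {ℓ + 1}, J', K' ∪ {ℓ + 1}, hJK,
      ⟨?_, ?_, hJ', hcard _ hK'⟩, ⟨x1, ?_, x3, ?_⟩, rfl⟩))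
  · exact disjoint_union_left.mpr ⟨hd, disjoint_singleton_left.mpr hnK'⟩
  · rw [union_right_comm, hu, hS]
  · exact fun h => x1 (hsub _ h)
  · exact fun h => x3 (subset_union_left.trans h)
  · exact disjoint_union_right.mpr ⟨hd, disjoint_singleton_right.mpr hnJ'⟩
  · rw [← union_assoc, hu, hS]
  · exact fun h => x2 (hsub _ h)
  · exact fun h => x4 (subset_union_left.trans h)

theorem good_sub (ℓ : ℕ) (J K : Finset ℕ)
    (hdisj : Disjoint J K) (hun : J ∪ K = Iset ℓ) (T : Finset ℕ) (hT : 2 ≤ T.card)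
    (h : (T ⊆ J ∧ T ≠ J) ∨ (T ⊆ K ∧ T ≠ K)) :
    cxD ℤ (Iset ℓ) (Iset ℓ \ T) T ∈ goodSub ℓ J K := by
  apply good_of_range
  rcases h with h | h
  · exact range_left _ _ _ _ (mem_range_FJcx ℓ K J T hdisj.symm
      (by rw [union_comm]; exact hun) h.1 h.2 hT)
  · exact range_right _ _ _ _ (mem_range_FJcx ℓ J K T hdisj hun h.1 h.2 hT)

/-- Every variable other than `D_{J,K}` is good. -/
theorem good_ne (ℓ : ℕ) (J K : Finset ℕ)
    (hdisj : Disjoint J K) (hun : J ∪ K = Iset ℓ) (hJ : 2 ≤ J.card) (hK : 2 ≤ K.card)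
    (J' K' : Finset ℕ) (hd : Disjoint J' K') (hu : J' ∪ K' = Iset ℓ)
    (hJ' : 2 ≤ J'.card) (hK' : 2 ≤ K'.card) (hne1 : J' ≠ J) (hne2 : J' ≠ K) :
    cxD ℤ (Iset ℓ) J' K' ∈ goodSub ℓ J K := by
  have eK : K = Iset ℓ \ J := by
    rw [← hun, Finset.union_sdiff_left, Finset.sdiff_eq_self_of_disjoint hdisj.symm]
  have eK' : K' = Iset ℓ \ J' := by
    rw [← hu, Finset.union_sdiff_left, Finset.sdiff_eq_self_of_disjoint hd.symm]
  have eJ' : J' = Iset ℓ \ K' := by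
    rw [← hu, Finset.union_sdiff_right, Finset.sdiff_eq_self_of_disjoint hd]
  have eJ : J = Iset ℓ \ K := by
    rw [← hun, Finset.union_sdiff_right, Finset.sdiff_eq_self_of_disjoint hdisj]
  have hne3 : K' ≠ J := fun h => hne2 (by rw [eJ', eK, h])
  have hne4 : K' ≠ K := fun h => hne1 (by rw [eJ', eJ, h])
  have g1 : ((J' ⊆ J ∧ J' ≠ J) ∨ (J' ⊆ K ∧ J' ≠ K)) →
      cxD ℤ (Iset ℓ) J' K' ∈ goodSub ℓ J K := fun h => by
    rw [cxD_comm, eK']; exact good_sub ℓ J K hdisj hun J' hJ' h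
  have g2 : ((K' ⊆ J ∧ K' ≠ J) ∨ (K' ⊆ K ∧ K' ≠ K)) →
      cxD ℤ (Iset ℓ) J' K' ∈ goodSub ℓ J K := fun h => by
    have := good_sub ℓ J K hdisj hun K' hK' h
    rwa [← eJ'] at this
  by_cases c1 : J ⊆ J'
  · exact g2 (Or.inr ⟨by rw [eK', eK]; exact sdiff_subset_sdiff Subset.rfl c1, hne4⟩)
  by_cases c2 : J ⊆ K'
  · exact g1 (Or.inr ⟨by rw [eJ', eK]; exact sdiff_subset_sdiff Subset.rfl c2, hne2⟩)
  by_cases c3 : J' ⊆ J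
  · exact g1 (Or.inl ⟨c3, hne1⟩)
  by_cases c4 : K' ⊆ J
  · exact g2 (Or.inl ⟨c4, hne3⟩)
  exact good_cross ℓ J K hdisj hun hJ hK J' K' hd hu hJ' hK' ⟨c1, c2, c3, c4⟩

theorem good_self (ℓ : ℕ) (J K : Finset ℕ)
    (hdisj : Disjoint J K) (hun : J ∪ K = Iset ℓ) (hJ : 2 ≤ J.card) (hK : 2 ≤ K.card) :
    cxD ℤ (Iset ℓ) J K ∈ goodSub ℓ J K := by
  obtain ⟨a, ha, b, hb, hab⟩ := Finset.one_lt_card.mp hJ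
  obtain ⟨c, hc, d, hd, hcd⟩ := Finset.one_lt_card.mp hK
  have eK : Iset ℓ \ J = K := by
    rw [← hun, Finset.union_sdiff_left, Finset.sdiff_eq_self_of_disjoint hdisj.symm]
  have hne : ∀ {x y : ℕ}, x ∈ J → y ∈ K → x ≠ y := fun hx hy h =>
    Finset.disjoint_left.mp hdisj hx (h ▸ hy)
  have hJs : J ⊆ Iset ℓ := hun ▸ subset_union_left
  have hKs : K ⊆ Iset ℓ := hun ▸ subset_union_right
  have hrel : halfRel (Iset ℓ) a b c d - halfRel (Iset ℓ) a c b d ∈ goodSub ℓ J K := by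
    apply good_of_ann
    rw [mem_annI]
    exact Ideal.mul_mem_left _ _ (Fcx_rel_mem ℓ a b c d (hJs ha) (hJs hb) (hKs hc) (hKs hd)
      hab hcd (hne ha hc) (hne hb hd))
  have h2 : halfRel (Iset ℓ) a c b d ∈ goodSub ℓ J K := by
    refine Subalgebra.sum_mem _ fun J' hJ' => ?_
    split_ifs with h
    · obtain ⟨c1, c2, h1, h2, h3, h4⟩ := h
      refine good_ne ℓ J K hdisj hun hJ hK J' _ disjoint_sdiff
        (union_sdiff_of_subset (mem_powerset.mp hJ')) c1 c2 ?_ ?_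
      · rintro rfl; exact (mem_sdiff.mp h3).2 hb
      · rintro rfl; exact (mem_sdiff.mp h4).2 hd
    · exact Subalgebra.zero_mem _
  have hmem : J ∈ (Iset ℓ).powerset := mem_powerset.mpr hJs
  have h1 : halfRel (Iset ℓ) a b c d - cxD ℤ (Iset ℓ) J K ∈ goodSub ℓ J K := by
    unfold halfRel
    rw [← Finset.add_sum_erase _ _ hmem, eK, if_pos ⟨hJ, hK, ha, hb, hc, hd⟩, add_sub_cancel_left]
    refine Subalgebra.sum_mem _ fun J' hJ' => ?_
    rw [mem_erase] at hJ'
    split_ifs with h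
    · obtain ⟨c1, c2, h1, h2, h3, h4⟩ := h
      refine good_ne ℓ J K hdisj hun hJ hK J' _ disjoint_sdiff
        (union_sdiff_of_subset (mem_powerset.mp hJ'.2)) c1 c2 hJ'.1 ?_
      rintro rfl; exact (mem_sdiff.mp h3).2 hc
    · exact Subalgebra.zero_mem _
  have := Subalgebra.sub_mem _ (Subalgebra.add_mem _ hrel h2) h1
  rwa [sub_add_cancel, sub_sub_cancel] at this

theorem good_X (ℓ : ℕ) (J K : Finset ℕ)
    (hdisj : Disjoint J K) (hun : J ∪ K = Iset ℓ) (hJ : 2 ≤ J.card) (hK : 2 ≤ K.card)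
    (i : CxIdx (Iset ℓ)) : (X i : CxRing ℤ (Iset ℓ)) ∈ goodSub ℓ J K := by
  rw [X_eq_cxD]
  obtain ⟨J', hs, c1, c2, -⟩ := i
  change cxD ℤ (Iset ℓ) J' (Iset ℓ \ J') ∈ _
  have eK : Iset ℓ \ J = K := by
    rw [← hun, Finset.union_sdiff_left, Finset.sdiff_eq_self_of_disjoint hdisj.symm]
  have eJ : Iset ℓ \ K = J := by
    rw [← hun, Finset.union_sdiff_right, Finset.sdiff_eq_self_of_disjoint hdisj]
  by_cases h1 : J' = J
  · subst h1; rw [eK]; exact good_self ℓ J' K hdisj hun hJ hK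
  by_cases h2 : J' = K
  · subst h2; rw [eJ, cxD_comm]; exact good_self ℓ J J' hdisj hun hJ hK
  exact good_ne ℓ J K hdisj hun hJ hK J' _ disjoint_sdiff (union_sdiff_of_subset hs) c1 c2 h1 h2

/-- `D̃⁰_{J,K}·(Im F) ⊆ D̃⁰_{J,K}·(Im (F ∘ F_{J,K})) + I_{[ℓ+1]}`. -/
theorem stmt5 (ℓ : ℕ) (hℓ : 3 ≤ ℓ) (J K : Finset ℕ)
    (hdisj : Disjoint J K) (hun : J ∪ K = Iset ℓ) (hJ : 2 ≤ J.card) (hK : 2 ≤ K.card)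
    (h1 : 1 ∈ J) :
    ∀ p : CxRing ℤ (Iset ℓ),
      ∃ q : TensorProduct ℤ (CxRing ℤ (insert 0 J)) (CxRing ℤ (insert 0 K)),
        cxD ℤ (Iset (ℓ + 1)) J (K ∪ {ℓ + 1}) *
            (Fcx ℤ ℓ p - Fcx ℤ ℓ (FJKcx ℤ ℓ J K q)) ∈ cxIdeal ℤ (Iset (ℓ + 1)) := by
  intro p
  have hp : p ∈ goodSub ℓ J K := by
    induction p using MvPolynomial.induction_on with
    | C n => exact Subalgebra.algebraMap_mem _ n
    | add p q hp hq => exact Subalgebra.add_mem _ hp hq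
    | mul_X p i hp => exact Subalgebra.mul_mem _ hp (good_X ℓ J K hdisj hun hJ hK i)
  obtain ⟨q, hq⟩ := hp
  exact ⟨q, (mem_annI ℓ J K _).mp (Ideal.Quotient.eq.mp hq.symm)⟩
end
end

section
/- Let ℓ≥2 be an integer and R a commutative ring with unity. For every p ∈ R_{0,[ℓ+1]} there exist a, a₀ ∈ R_{0,[ℓ]} and, for each {J,K}∈P([ℓ]) with 1∈J, elements b_{J,K}, c_{J,K} ∈ R_{0,[ℓ]} and, for each (I,{J,K})∈P̃•([ℓ]) with min(J∪K)∈J, elements b_{I;J,K}, c_{I;J,K} ∈ R_{0,[ℓ]}, such that p − (F(a) + D̃⁰₁·F(a₀) + Σ_{{J,K}} (ℝẼ⁰_{J,K}·F(b_{J,K}) + ℝẼ⁻_{J,K}·F(c_{J,K})) + Σ_{(I,{J,K})} (ℝD̃⁰_{I;J,K}·F(b_{I;J,K}) + ℝD̃⁻_{I;J,K}·F(c_{I;J,K}))) ∈ I_{0,[ℓ+1]}. In other words, R_{0,[ℓ+1]} equals the sum of I_{0,[ℓ+1]} and the (Im F)-submodule generated by 1, D̃⁰₁, the elements ℝẼ⁰_{J,K},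 ℝẼ⁻_{J,K}, and the elements ℝD̃⁰_{I;J,K}, ℝD̃⁻_{I;J,K}. -/
open MvPolynomial Finset TensorProduct

noncomputable section

/-! ### Basic facts on variables -/

lemma reD_symm (R : Type) [CommRing R] (S I J K : Finset ℕ) :
    reD R S I J K = reD R S I K J := by
  unfold reD
  by_cases h : Disjoint I (J ∪ K) ∧ Disjoint J K ∧ I ∪ (J ∪ K) = S
  · have h' : Disjoint I (K ∪ J) ∧ Disjoint K J ∧ I ∪ (K ∪ J) = S := by
      rw [union_comm K J]; exact ⟨h.1, h.2.1.symm, h.2.2⟩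
    rw [if_pos h, if_pos h']
    by_cases h1 : J.min ≤ K.min <;> by_cases h2 : K.min ≤ J.min
    · have e := le_antisymm h1 h2
      rcases J.eq_empty_or_nonempty with hJ | hJ
      · subst hJ
        have : K = ∅ := by
          rw [Finset.min_empty] at e
          exact Finset.min_eq_top.1 e.symm
        subst this; rfl
      · obtain ⟨m, hm⟩ := Finset.min_of_nonempty hJ
        have a := Finset.mem_of_min hm
        have b := Finset.mem_of_min (e ▸ hm)
        exact absurd b (Finset.disjoint_left.1 h.2.1 a)
    · simp [h1, h2]
    · simp [h1, h2]
    · exact absurd (le_of_not_ge h1) h2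
  · have h' : ¬ (Disjoint I (K ∪ J) ∧ Disjoint K J ∧ I ∪ (K ∪ J) = S) := by
      rw [union_comm K J, disjoint_comm (a := K)]; exact h
    rw [if_neg h, if_neg h']

lemma reE_symm (R : Type) [CommRing R] (S J K : Finset ℕ) :
    reE R S J K = reE R S K J := by
  unfold reE
  by_cases h : Disjoint J K ∧ J ∪ K = S
  · have h' : Disjoint K J ∧ K ∪ J = S := by
      rw [union_comm K J]; exact ⟨h.1.symm, h.2⟩
    rw [if_pos h, if_pos h']
    by_cases h1 : J.min ≤ K.min <;> by_cases h2 : K.min ≤ J.min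
    · have e := le_antisymm h1 h2
      rcases J.eq_empty_or_nonempty with hJ | hJ
      · subst hJ
        have : K = ∅ := by
          rw [Finset.min_empty] at e
          exact Finset.min_eq_top.1 e.symm
        subst this; rfl
      · obtain ⟨m, hm⟩ := Finset.min_of_nonempty hJ
        have a := Finset.mem_of_min hm
        have b := Finset.mem_of_min (e ▸ hm)
        exact absurd b (Finset.disjoint_left.1 h.1 a)
    · simp [h1, h2]
    · simp [h1, h2]
    · exact absurd (le_of_not_ge h1) h2
  · have h' : ¬ (Disjoint K J ∧ K ∪ J = S) := by
      rw [union_comm K J, disjoint_comm (a := K)]; exact h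
    rw [if_neg h, if_neg h']

lemma reD_invalid (R : Type) [CommRing R] (S I J K : Finset ℕ) (h : ¬ validD S I J K) :
    reD R S I J K = 0 := by
  unfold reD
  split_ifs with h1 h2
  · unfold reXd
    rw [dif_neg]
    rintro ⟨a, b, c, d, e⟩
    apply h
    refine ⟨h1.1, h1.2.1, h1.2.2, c, ?_⟩
    have : S \ I = J ∪ K := by
      rw [← h1.2.2, union_sdiff_left, sdiff_eq_self_of_disjoint h1.1.symm]
    rwa [this] at d
  · unfold reXd
    rw [dif_neg]
    rintro ⟨a, b, c, d, e⟩
    apply h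
    refine ⟨h1.1, h1.2.1, h1.2.2, c, ?_⟩
    have : S \ I = J ∪ K := by
      rw [← h1.2.2, union_sdiff_left, sdiff_eq_self_of_disjoint h1.1.symm]
    rwa [this] at d
  · rfl

lemma reE_invalid (R : Type) [CommRing R] (S J K : Finset ℕ) (h : ¬ validE S J K) :
    reE R S J K = 0 := by
  unfold reE
  rw [if_neg h]

lemma DD_mem (R : Type) [CommRing R] (S I J K I' J' K' : Finset ℕ)
    (h1 : ¬ preceq J K J' K') (h2 : ¬ preceq J' K' J K) (h3 : ¬ J ∪ K ⊆ I') :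
    reD R S I J K * reD R S I' J' K' ∈ reIdeal R S := by
  by_cases v : validD S I J K
  · by_cases v' : validD S I' J' K'
    · apply Ideal.subset_span
      left; left; right
      exact ⟨I, J, K, I', J', K', v, v', h1, h2, h3, rfl⟩
    · rw [reD_invalid _ _ _ _ _ v', mul_zero]; exact zero_mem _
  · rw [reD_invalid _ _ _ _ _ v, zero_mul]; exact zero_mem _

lemma ED_mem (R : Type) [CommRing R] (S J K I' J' K' : Finset ℕ)
    (h1 : ¬ preceq J' K' J K) :
    reE R S J K * reD R S I' J' K' ∈ reIdeal R S := by
  by_cases v : validE S J K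
  · by_cases v' : validD S I' J' K'
    · apply Ideal.subset_span
      left; left; left; right
      exact ⟨J, K, I', J', K', v, v', h1, rfl⟩
    · rw [reD_invalid _ _ _ _ _ v', mul_zero]; exact zero_mem _
  · rw [reE_invalid _ _ _ _ v, zero_mul]; exact zero_mem _

lemma EE_mem (R : Type) [CommRing R] (S J K J' K' : Finset ℕ) :
    reE R S J K * reE R S J' K' ∈ reIdeal R S := by
  by_cases v : validE S J K
  · by_cases v' : validE S J' K'
    · apply Ideal.subset_span
      left; left; left; left
      exact ⟨J, K, J', K', v, v', rfl⟩
    · rw [reE_invalid _ _ _ _ v', mul_zero]; exact zero_mem _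
  · rw [reE_invalid _ _ _ _ v, zero_mul]; exact zero_mem _

/-- Location condition for the terms of `relE`. -/
def condE (a b c : ℕ) (I J K : Finset ℕ) : Prop :=
  (a ∈ J ∧ b ∈ J ∧ c ∈ I) ∨ (a ∈ J ∧ c ∈ J ∧ b ∈ I) ∨ (a ∈ I ∧ b ∈ J ∧ c ∈ K)

/-- Extracting one term of the relation `E_{abc}`. -/
lemma rel_extract (R : Type) [CommRing R] (S : Finset ℕ) (a b c : ℕ)
    (N : AddSubgroup (RRing R S)) (hN : relE R S a b c ∈ N) (I₀ J₀ K₀ : Finset ℕ)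
    (hv : validD S I₀ J₀ K₀) (hc : condE a b c I₀ J₀ K₀)
    (H : ∀ I J K, validD S I J K → condE a b c I J K → ¬ (I = I₀ ∧ J = J₀ ∧ K = K₀) →
      reD R S I J K ∈ N) : reD R S I₀ J₀ K₀ ∈ N := by
  have hS : ∀ I J K, validD S I J K → S \ I = J ∪ K := by
    intro I J K h
    rw [← h.2.2.1, union_sdiff_left, sdiff_eq_self_of_disjoint h.1.symm]
  have hK0 : (S \ I₀) \ J₀ = K₀ := by
    rw [hS _ _ _ hv, union_sdiff_left, sdiff_eq_self_of_disjoint hv.2.1.symm]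
  set t : Finset ℕ → Finset ℕ → RRing R S := fun I J =>
    (if 1 ≤ I.card ∧ 2 ≤ (S \ I).card ∧ a ∈ J ∧ b ∈ J ∧ c ∈ I
      then epsm J ((S \ I) \ J) • reD R S I J ((S \ I) \ J) else 0)
    - (if 1 ≤ I.card ∧ 2 ≤ (S \ I).card ∧ a ∈ J ∧ c ∈ J ∧ b ∈ I
      then epsm J ((S \ I) \ J) • reD R S I J ((S \ I) \ J) else 0)
    - (if 1 ≤ I.card ∧ 2 ≤ (S \ I).card ∧ a ∈ I ∧ b ∈ J ∧ c ∈ (S \ I) \ J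
      then epsm J ((S \ I) \ J) • reD R S I J ((S \ I) \ J) else 0) with ht
  have e1 : relE R S a b c = ∑ I ∈ S.powerset, ∑ J ∈ (S \ I).powerset, t I J := by
    simp only [relE, ht, Finset.sum_sub_distrib]
  have hz : ∀ I J, ¬ (I = I₀ ∧ J = J₀) → t I J ∈ N := by
    intro I J hne
    have key : ∀ P : Prop, [Decidable P] → (P → condE a b c I J ((S \ I) \ J)) →
        (if P then epsm J ((S \ I) \ J) • reD R S I J ((S \ I) \ J) else 0) ∈ N := by
      intro P _ hP
      split_ifs with h
      · apply N.zsmul_mem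
        by_cases v : validD S I J ((S \ I) \ J)
        · exact H _ _ _ v (hP h) (fun h => hne ⟨h.1, h.2.1⟩)
        · rw [reD_invalid _ _ _ _ _ v]; exact N.zero_mem
      · exact N.zero_mem
    refine N.sub_mem (N.sub_mem (key _ ?_) (key _ ?_)) (key _ ?_)
    · rintro ⟨-, -, h⟩; exact Or.inl h
    · rintro ⟨-, -, h⟩; exact Or.inr (Or.inl h)
    · rintro ⟨-, -, h⟩; exact Or.inr (Or.inr h)
  have hI0 : I₀ ∈ S.powerset := by
    rw [Finset.mem_powerset, ← hv.2.2.1]; exact subset_union_left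
  have hJ0 : J₀ ∈ (S \ I₀).powerset := by
    rw [Finset.mem_powerset, hS _ _ _ hv]; exact subset_union_left
  have h0 : t I₀ J₀ ∈ N := by
    rw [e1, ← Finset.add_sum_erase _ _ hI0, ← Finset.add_sum_erase _ _ hJ0] at hN
    have h1 : ∑ J ∈ ((S \ I₀).powerset).erase J₀, t I₀ J ∈ N :=
      N.sum_mem fun J hJ => hz _ _ (fun h => (Finset.mem_erase.1 hJ).1 h.2)
    have h2 : ∑ I ∈ S.powerset.erase I₀, ∑ J ∈ (S \ I).powerset, t I J ∈ N :=
      N.sum_mem fun I hI => N.sum_mem fun J _ =>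
        hz _ _ (fun h => (Finset.mem_erase.1 hI).1 h.1)
    exact (N.add_mem_cancel_right h1).1 ((N.add_mem_cancel_right h2).1 hN)
  have heps : ∀ x : RRing R S, epsm J₀ K₀ • x ∈ N → x ∈ N := by
    intro x hx
    unfold epsm at hx
    split_ifs at hx
    · simpa using hx
    · simpa using hx
  have hc1 : 2 ≤ (S \ I₀).card := by rw [hS _ _ _ hv]; exact hv.2.2.2.2
  have hc0 := hv.2.2.2.1
  have d1 : ∀ x, x ∈ I₀ → x ∉ J₀ := fun x hx hy =>
    Finset.disjoint_left.1 hv.1 hx (Finset.mem_union_left _ hy)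
  apply heps
  simp only [ht, hK0, hc0, hc1, true_and] at h0
  rcases hc with h | h | h
  · have n2 : ¬ (a ∈ J₀ ∧ c ∈ J₀ ∧ b ∈ I₀) := fun g => d1 _ g.2.2 h.2.1
    have n3 : ¬ (a ∈ I₀ ∧ b ∈ J₀ ∧ c ∈ K₀) := fun g => d1 _ g.1 h.1
    simpa [if_pos h, if_neg n2, if_neg n3] using h0
  · have n2 : ¬ (a ∈ J₀ ∧ b ∈ J₀ ∧ c ∈ I₀) := fun g => d1 _ h.2.2 g.2.1
    have n3 : ¬ (a ∈ I₀ ∧ b ∈ J₀ ∧ c ∈ K₀) := fun g => d1 _ g.1 h.1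
    simpa [if_pos h, if_neg n2, if_neg n3] using h0
  · have n2 : ¬ (a ∈ J₀ ∧ b ∈ J₀ ∧ c ∈ I₀) := fun g => d1 _ h.1 g.1
    have n3 : ¬ (a ∈ J₀ ∧ c ∈ J₀ ∧ b ∈ I₀) := fun g => d1 _ h.1 g.1
    simpa [if_pos h, if_neg n2, if_neg n3] using h0

/-! ### The candidate submodule -/

/-- The combination of generators with given coefficients. -/
def combM (R : Type) [CommRing R] (ℓ : ℕ) (a a₀ : RRing R (Iset ℓ))
    (bE cE : Finset ℕ → RRing R (Iset ℓ))
    (bD cD : Finset ℕ → Finset ℕ → RRing R (Iset ℓ)) : RRing R (Iset (ℓ + 1)) :=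
  Fre R ℓ a +
    reD R (Iset (ℓ + 1)) (Iset ℓ \ {1}) {1, ℓ + 1} ∅ * Fre R ℓ a₀ +
    (∑ J ∈ (Iset ℓ).powerset.filter (fun J => 1 ∈ J),
      (reEt0 R ℓ J (Iset ℓ \ J) * Fre R ℓ (bE J) +
       reEtm R ℓ J (Iset ℓ \ J) * Fre R ℓ (cE J))) +
    ∑ I ∈ (Iset ℓ).powerset.filter (fun I => 1 ≤ I.card ∧ 2 ≤ (Iset ℓ \ I).card),
      ∑ J ∈ (Iset ℓ \ I).powerset.filter (fun J => J.min = (Iset ℓ \ I).min),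
        (reDt0 R ℓ I J ((Iset ℓ \ I) \ J) * Fre R ℓ (bD I J) +
         reDtm R ℓ I J ((Iset ℓ \ I) \ J) * Fre R ℓ (cD I J))

lemma combM_add (R : Type) [CommRing R] (ℓ : ℕ) (a a₀ bE cE bD cD a' a₀' bE' cE' bD' cD') :
    combM R ℓ (a + a') (a₀ + a₀') (bE + bE') (cE + cE') (bD + bD') (cD + cD') =
      combM R ℓ a a₀ bE cE bD cD + combM R ℓ a' a₀' bE' cE' bD' cD' := by
  simp only [combM, Pi.add_apply, map_add, mul_add, Finset.sum_add_distrib]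
  ring

lemma combM_neg (R : Type) [CommRing R] (ℓ : ℕ) (a a₀ bE cE bD cD) :
    combM R ℓ (-a) (-a₀) (-bE) (-cE) (-bD) (-cD) = - combM R ℓ a a₀ bE cE bD cD := by
  simp only [combM, Pi.neg_apply, map_neg, mul_neg, Finset.sum_add_distrib,
    Finset.sum_neg_distrib]
  ring

lemma combM_mul (R : Type) [CommRing R] (ℓ : ℕ) (x a a₀ bE cE bD cD) :
    combM R ℓ (x * a) (x * a₀) (fun J => x * bE J) (fun J => x * cE J)
      (fun I J => x * bD I J) (fun I J => x * cD I J) =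
      Fre R ℓ x * combM R ℓ a a₀ bE cE bD cD := by
  simp only [combM, map_mul, mul_add, Finset.mul_sum, mul_left_comm (Fre R ℓ x)]

/-- The submodule of the statement (as an additive subgroup). -/
def subM (R : Type) [CommRing R] (ℓ : ℕ) : AddSubgroup (RRing R (Iset (ℓ + 1))) where
  carrier := {p | ∃ a a₀ bE cE bD cD,
    p - combM R ℓ a a₀ bE cE bD cD ∈ reIdeal R (Iset (ℓ + 1))}
  zero_mem' := ⟨0, 0, 0, 0, 0, 0, by simp [combM]⟩
  add_mem' := by
    rintro p q ⟨a, a₀, bE, cE, bD, cD, h⟩ ⟨a', a₀', bE', cE', bD', cD', h'⟩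
    refine ⟨a + a', a₀ + a₀', bE + bE', cE + cE', bD + bD', cD + cD', ?_⟩
    rw [combM_add, add_sub_add_comm]
    exact add_mem h h'
  neg_mem' := by
    rintro p ⟨a, a₀, bE, cE, bD, cD, h⟩
    refine ⟨-a, -a₀, -bE, -cE, -bD, -cD, ?_⟩
    rw [combM_neg]
    have := neg_mem h
    convert this using 1
    ring

lemma subM_ideal (R : Type) [CommRing R] (ℓ : ℕ) {p} (hp : p ∈ reIdeal R (Iset (ℓ + 1))) :
    p ∈ subM R ℓ := ⟨0, 0, 0, 0, 0, 0, by simpa [combM] using hp⟩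

lemma subM_mulF (R : Type) [CommRing R] (ℓ : ℕ) (x) {p} (hp : p ∈ subM R ℓ) :
    p * Fre R ℓ x ∈ subM R ℓ := by
  obtain ⟨a, a₀, bE, cE, bD, cD, h⟩ := hp
  refine ⟨x * a, x * a₀, fun J => x * bE J, fun J => x * cE J,
    fun I J => x * bD I J, fun I J => x * cD I J, ?_⟩
  rw [combM_mul, mul_comm p, ← mul_sub]
  exact Ideal.mul_mem_left _ _ h

lemma subM_one (R : Type) [CommRing R] (ℓ : ℕ) : (1 : RRing R (Iset (ℓ + 1))) ∈ subM R ℓ :=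
  ⟨1, 0, 0, 0, 0, 0, by simp [combM]⟩

lemma subM_F (R : Type) [CommRing R] (ℓ : ℕ) (x) : Fre R ℓ x ∈ subM R ℓ := by
  simpa using subM_mulF R ℓ x (subM_one R ℓ)

lemma subM_s (R : Type) [CommRing R] (ℓ : ℕ) :
    reD R (Iset (ℓ + 1)) (Iset ℓ \ {1}) {1, ℓ + 1} ∅ ∈ subM R ℓ :=
  ⟨0, 1, 0, 0, 0, 0, by simp [combM]⟩

lemma subM_e0 (R : Type) [CommRing R] (ℓ : ℕ) (J : Finset ℕ) (hJ : J ⊆ Iset ℓ) (h1 : 1 ∈ J) :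
    reEt0 R ℓ J (Iset ℓ \ J) ∈ subM R ℓ := by
  refine ⟨0, 0, Pi.single J 1, 0, 0, 0, ?_⟩
  have : combM R ℓ 0 0 (Pi.single J 1) 0 0 0 = reEt0 R ℓ J (Iset ℓ \ J) := by
    simp only [combM]
    rw [Finset.sum_eq_single J]
    · simp
    · intro b _ hb; simp [Pi.single_eq_of_ne hb]
    · intro h; exact absurd (by simp [hJ, h1]) h
  rw [this, sub_self]; exact zero_mem _

lemma subM_em (R : Type) [CommRing R] (ℓ : ℕ) (J : Finset ℕ) (hJ : J ⊆ Iset ℓ) (h1 : 1 ∈ J) :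
    reEtm R ℓ J (Iset ℓ \ J) ∈ subM R ℓ := by
  refine ⟨0, 0, 0, Pi.single J 1, 0, 0, ?_⟩
  have : combM R ℓ 0 0 0 (Pi.single J 1) 0 0 = reEtm R ℓ J (Iset ℓ \ J) := by
    simp only [combM]
    rw [Finset.sum_eq_single J]
    · simp
    · intro b _ hb; simp [Pi.single_eq_of_ne hb]
    · intro h; exact absurd (by simp [hJ, h1]) h
  rw [this, sub_self]; exact zero_mem _

lemma subM_d0 (R : Type) [CommRing R] (ℓ : ℕ) (I J : Finset ℕ) (hI : I ⊆ Iset ℓ)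
    (hc : 1 ≤ I.card ∧ 2 ≤ (Iset ℓ \ I).card) (hJ : J ⊆ Iset ℓ \ I)
    (h1 : J.min = (Iset ℓ \ I).min) :
    reDt0 R ℓ I J ((Iset ℓ \ I) \ J) ∈ subM R ℓ := by
  refine ⟨0, 0, 0, 0, Pi.single I (Pi.single J 1), 0, ?_⟩
  have : combM R ℓ 0 0 0 0 (Pi.single I (Pi.single J 1)) 0 =
      reDt0 R ℓ I J ((Iset ℓ \ I) \ J) := by
    simp only [combM, Pi.zero_apply, map_zero, mul_zero, Finset.sum_const_zero, zero_add,
      add_zero]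
    rw [Finset.sum_eq_single I, Finset.sum_eq_single J]
    · simp
    · intro b _ hb; simp [Pi.single_eq_of_ne hb]
    · intro h
      exact absurd (Finset.mem_filter.2 ⟨Finset.mem_powerset.2 hJ, h1⟩) h
    · intro b _ hb; simp [Pi.single_eq_of_ne hb]
    · intro h
      exact absurd (Finset.mem_filter.2 ⟨Finset.mem_powerset.2 hI, hc⟩) h
  rw [this, sub_self]; exact zero_mem _

lemma subM_dm (R : Type) [CommRing R] (ℓ : ℕ) (I J : Finset ℕ) (hI : I ⊆ Iset ℓ)
    (hc : 1 ≤ I.card ∧ 2 ≤ (Iset ℓ \ I).card) (hJ : J ⊆ Iset ℓ \ I)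
    (h1 : J.min = (Iset ℓ \ I).min) :
    reDtm R ℓ I J ((Iset ℓ \ I) \ J) ∈ subM R ℓ := by
  refine ⟨0, 0, 0, 0, 0, Pi.single I (Pi.single J 1), ?_⟩
  have : combM R ℓ 0 0 0 0 0 (Pi.single I (Pi.single J 1)) =
      reDtm R ℓ I J ((Iset ℓ \ I) \ J) := by
    simp only [combM, Pi.zero_apply, map_zero, mul_zero, Finset.sum_const_zero, zero_add,
      add_zero]
    rw [Finset.sum_eq_single I, Finset.sum_eq_single J]
    · simp
    · intro b _ hb; simp [Pi.single_eq_of_ne hb]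
    · intro h
      exact absurd (Finset.mem_filter.2 ⟨Finset.mem_powerset.2 hJ, h1⟩) h
    · intro b _ hb; simp [Pi.single_eq_of_ne hb]
    · intro h
      exact absurd (Finset.mem_filter.2 ⟨Finset.mem_powerset.2 hI, hc⟩) h
  rw [this, sub_self]; exact zero_mem _

/-- Generators (closed under the evident symmetry). -/
inductive GenM (R : Type) [CommRing R] (ℓ : ℕ) : RRing R (Iset (ℓ + 1)) → Prop
  | one : GenM R ℓ 1
  | sec : GenM R ℓ (reD R (Iset (ℓ + 1)) (Iset ℓ \ {1}) {1, ℓ + 1} ∅)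
  | e0 (J K : Finset ℕ) (h : validE (Iset ℓ) J K) :
      GenM R ℓ (reD R (Iset (ℓ + 1)) {ℓ + 1} J K)
  | ep (J K : Finset ℕ) (h : validE (Iset ℓ) J K) :
      GenM R ℓ (reE R (Iset (ℓ + 1)) (J ∪ {ℓ + 1}) K)
  | dI (I J K : Finset ℕ) (h : validD (Iset ℓ) I J K) :
      GenM R ℓ (reD R (Iset (ℓ + 1)) (I ∪ {ℓ + 1}) J K)
  | dJ (I J K : Finset ℕ) (h : validD (Iset ℓ) I J K) :
      GenM R ℓ (reD R (Iset (ℓ + 1)) I (J ∪ {ℓ + 1}) K)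

lemma validD_symm {S I J K : Finset ℕ} (h : validD S I J K) : validD S I K J := by
  obtain ⟨a, b, c, d, e⟩ := h
  refine ⟨by rwa [union_comm], b.symm, by rwa [union_comm K], d, by rwa [union_comm]⟩

lemma validE_symm {S J K : Finset ℕ} (h : validE S J K) : validE S K J :=
  ⟨h.1.symm, by rw [union_comm]; exact h.2⟩

lemma min_union_of_le {J K : Finset ℕ} (h : J.min ≤ K.min) : (J ∪ K).min = J.min := by
  rw [Finset.min_union]; exact min_eq_left h

lemma rowD (R : Type) [CommRing R] (ℓ : ℕ) {I J K : Finset ℕ} (h : validD (Iset ℓ) I J K) :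
    ∃ x, Fre R ℓ x = reD R (Iset (ℓ + 1)) (I ∪ {ℓ + 1}) J K
      + reD R (Iset (ℓ + 1)) I (J ∪ {ℓ + 1}) K + reD R (Iset (ℓ + 1)) I J (K ∪ {ℓ + 1}) := by
  have main : ∀ J K, validD (Iset ℓ) I J K → J.min ≤ K.min →
      ∃ x, Fre R ℓ x = reD R (Iset (ℓ + 1)) (I ∪ {ℓ + 1}) J K
      + reD R (Iset (ℓ + 1)) I (J ∪ {ℓ + 1}) K + reD R (Iset (ℓ + 1)) I J (K ∪ {ℓ + 1}) := by
    intro J K h hm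
    have hS : Iset ℓ \ I = J ∪ K := by
      rw [← h.2.2.1, union_sdiff_left, sdiff_eq_self_of_disjoint h.1.symm]
    have hK : (Iset ℓ \ I) \ J = K := by
      rw [hS, union_sdiff_left, sdiff_eq_self_of_disjoint h.2.1.symm]
    have hv : I ⊆ Iset ℓ ∧ J ⊆ Iset ℓ \ I ∧ 1 ≤ I.card ∧ 2 ≤ (Iset ℓ \ I).card ∧
        J.min = (Iset ℓ \ I).min := by
      refine ⟨h.2.2.1 ▸ subset_union_left, hS ▸ subset_union_left, h.2.2.2.1,
        hS ▸ h.2.2.2.2, ?_⟩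
      rw [hS, min_union_of_le hm]
    refine ⟨X (Sum.inr ⟨(I, J), hv⟩), ?_⟩
    simp only [Fre, aeval_X, hK]
  rcases le_total J.min K.min with hm | hm
  · exact main J K h hm
  · obtain ⟨x, hx⟩ := main K J (validD_symm h) hm
    refine ⟨x, ?_⟩
    rw [hx, reD_symm R _ _ K J, reD_symm R _ _ _ J, reD_symm R _ _ K _]
    ring

lemma rowE (R : Type) [CommRing R] (ℓ : ℕ) {J K : Finset ℕ} (h : validE (Iset ℓ) J K) :
    ∃ x, Fre R ℓ x = reE R (Iset (ℓ + 1)) (J ∪ {ℓ + 1}) K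
      + reE R (Iset (ℓ + 1)) J (K ∪ {ℓ + 1}) := by
  have main : ∀ J K, validE (Iset ℓ) J K → J.min ≤ K.min →
      ∃ x, Fre R ℓ x = reE R (Iset (ℓ + 1)) (J ∪ {ℓ + 1}) K
      + reE R (Iset (ℓ + 1)) J (K ∪ {ℓ + 1}) := by
    intro J K h hm
    have hK : Iset ℓ \ J = K := by
      rw [← h.2, union_sdiff_left, sdiff_eq_self_of_disjoint h.1.symm]
    have hv : J ⊆ Iset ℓ ∧ J.min = (Iset ℓ).min := by
      refine ⟨h.2 ▸ subset_union_left, ?_⟩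
      rw [← h.2, min_union_of_le hm]
    refine ⟨X (Sum.inl ⟨J, hv⟩), ?_⟩
    simp only [Fre, aeval_X, hK]
  rcases le_total J.min K.min with hm | hm
  · exact main J K h hm
  · obtain ⟨x, hx⟩ := main K J (validE_symm h) hm
    refine ⟨x, ?_⟩
    rw [hx, reE_symm R _ _ J, reE_symm R _ K _]
    ring

lemma subM_e0' (R : Type) [CommRing R] (ℓ : ℕ) (hℓ : 2 ≤ ℓ) {J K : Finset ℕ}
    (h : validE (Iset ℓ) J K) : reD R (Iset (ℓ + 1)) {ℓ + 1} J K ∈ subM R ℓ := by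
  have main : ∀ J K, validE (Iset ℓ) J K → 1 ∈ J →
      reD R (Iset (ℓ + 1)) {ℓ + 1} J K ∈ subM R ℓ := by
    intro J K h hm
    have hK : Iset ℓ \ J = K := by
      rw [← h.2, union_sdiff_left, sdiff_eq_self_of_disjoint h.1.symm]
    have := subM_e0 R ℓ J (h.2 ▸ subset_union_left) hm
    rwa [hK] at this
  have h1 : 1 ∈ J ∪ K := by rw [h.2]; simp; omega
  rcases Finset.mem_union.1 h1 with h1 | h1
  · exact main J K h h1
  · rw [reD_symm]; exact main K J (validE_symm h) h1

lemma subM_ep' (R : Type) [CommRing R] (ℓ : ℕ) (hℓ : 2 ≤ ℓ) {J K : Finset ℕ}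
    (h : validE (Iset ℓ) J K) : reE R (Iset (ℓ + 1)) (J ∪ {ℓ + 1}) K ∈ subM R ℓ := by
  have main : ∀ J K, validE (Iset ℓ) J K → 1 ∈ J →
      reE R (Iset (ℓ + 1)) J (K ∪ {ℓ + 1}) ∈ subM R ℓ := by
    intro J K h hm
    have hK : Iset ℓ \ J = K := by
      rw [← h.2, union_sdiff_left, sdiff_eq_self_of_disjoint h.1.symm]
    have := subM_em R ℓ J (h.2 ▸ subset_union_left) hm
    rwa [hK] at this
  have h1 : 1 ∈ J ∪ K := by rw [h.2]; simp; omega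
  rcases Finset.mem_union.1 h1 with h1 | h1
  · obtain ⟨x, hx⟩ := rowE R ℓ h
    rw [eq_sub_of_add_eq hx.symm]
    exact sub_mem (subM_F _ _ _) (main J K h h1)
  · rw [reE_symm]; exact main K J (validE_symm h) h1

lemma subM_d' (R : Type) [CommRing R] (ℓ : ℕ) {I J K : Finset ℕ}
    (h : validD (Iset ℓ) I J K) :
    reD R (Iset (ℓ + 1)) (I ∪ {ℓ + 1}) J K ∈ subM R ℓ ∧
    reD R (Iset (ℓ + 1)) I (J ∪ {ℓ + 1}) K ∈ subM R ℓ ∧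
    reD R (Iset (ℓ + 1)) I J (K ∪ {ℓ + 1}) ∈ subM R ℓ := by
  have main : ∀ J K, validD (Iset ℓ) I J K → J.min ≤ K.min →
      reD R (Iset (ℓ + 1)) (I ∪ {ℓ + 1}) J K ∈ subM R ℓ ∧
      reD R (Iset (ℓ + 1)) I (J ∪ {ℓ + 1}) K ∈ subM R ℓ ∧
      reD R (Iset (ℓ + 1)) I J (K ∪ {ℓ + 1}) ∈ subM R ℓ := by
    intro J K h hm
    have hS : Iset ℓ \ I = J ∪ K := by
      rw [← h.2.2.1, union_sdiff_left, sdiff_eq_self_of_disjoint h.1.symm]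
    have hK : (Iset ℓ \ I) \ J = K := by
      rw [hS, union_sdiff_left, sdiff_eq_self_of_disjoint h.2.1.symm]
    have a1 : I ⊆ Iset ℓ := h.2.2.1 ▸ subset_union_left
    have a2 : J ⊆ Iset ℓ \ I := hS ▸ subset_union_left
    have a3 : 1 ≤ I.card ∧ 2 ≤ (Iset ℓ \ I).card := ⟨h.2.2.2.1, hS ▸ h.2.2.2.2⟩
    have a4 : J.min = (Iset ℓ \ I).min := by rw [hS, min_union_of_le hm]
    have g0 := subM_d0 R ℓ I J a1 a3 a2 a4
    have gm := subM_dm R ℓ I J a1 a3 a2 a4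
    rw [hK] at g0 gm
    obtain ⟨x, hx⟩ := rowD R ℓ h
    have hF := subM_F R ℓ x
    rw [hx] at hF
    unfold reDt0 at g0
    unfold reDtm at gm
    have hF' := (AddSubgroup.add_mem_cancel_right _ gm).1 hF
    split_ifs at g0
    · exact ⟨(AddSubgroup.add_mem_cancel_right _ g0).1 hF', g0, gm⟩
    · exact ⟨g0, (AddSubgroup.add_mem_cancel_left _ g0).1 hF', gm⟩
  rcases le_total J.min K.min with hm | hm
  · exact main J K h hm
  · obtain ⟨x, y, z⟩ := main K J (validD_symm h) hm
    rw [reD_symm] at x y z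
    exact ⟨x, z, y⟩

lemma GenM.mem {R : Type} [CommRing R] {ℓ : ℕ} (hℓ : 2 ≤ ℓ) {g} (h : GenM R ℓ g) :
    g ∈ subM R ℓ := by
  cases h with
  | one => exact subM_one _ _
  | sec => exact subM_s _ _
  | e0 J K h => exact subM_e0' _ _ hℓ h
  | ep J K h => exact subM_ep' _ _ hℓ h
  | dI I J K h => exact (subM_d' _ _ h).1
  | dJ I J K h => exact (subM_d' _ _ h).2.1

lemma subM_ind {R : Type} [CommRing R] {ℓ : ℕ} (N : AddSubgroup (RRing R (Iset (ℓ + 1))))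
    (hI : ∀ p ∈ reIdeal R (Iset (ℓ + 1)), p ∈ N)
    (hg : ∀ g, GenM R ℓ g → ∀ x, g * Fre R ℓ x ∈ N) {p} (hp : p ∈ subM R ℓ) : p ∈ N := by
  obtain ⟨a, a₀, bE, cE, bD, cD, h⟩ := hp
  have h1 := hI _ h
  have h2 : combM R ℓ a a₀ bE cE bD cD ∈ N := by
    unfold combM
    refine N.add_mem (N.add_mem (N.add_mem ?_ (hg _ .sec _)) ?_) ?_
    · simpa using hg _ .one a
    · refine N.sum_mem fun J hJ => ?_
      obtain ⟨hJ, -⟩ := Finset.mem_filter.1 hJ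
      have v : validE (Iset ℓ) J (Iset ℓ \ J) :=
        ⟨disjoint_sdiff, union_sdiff_of_subset (Finset.mem_powerset.1 hJ)⟩
      refine N.add_mem (hg _ (.e0 _ _ v) _) ?_
      unfold reEtm
      rw [reE_symm]
      exact hg _ (.ep _ _ (validE_symm v)) _
    · refine N.sum_mem fun I hI' => N.sum_mem fun J hJ => ?_
      obtain ⟨hI', hc⟩ := Finset.mem_filter.1 hI'
      obtain ⟨hJ, -⟩ := Finset.mem_filter.1 hJ
      have e : J ∪ ((Iset ℓ \ I) \ J) = Iset ℓ \ I :=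
        union_sdiff_of_subset (Finset.mem_powerset.1 hJ)
      have v : validD (Iset ℓ) I J ((Iset ℓ \ I) \ J) := by
        refine ⟨?_, disjoint_sdiff, ?_, hc.1, ?_⟩
        · rw [e]; exact disjoint_sdiff
        · rw [e]; exact union_sdiff_of_subset (Finset.mem_powerset.1 hI')
        · rw [e]; exact hc.2
      refine N.add_mem ?_ ?_
      · unfold reDt0
        split_ifs
        · exact hg _ (.dJ _ _ _ v) _
        · exact hg _ (.dI _ _ _ v) _
      · unfold reDtm
        rw [reD_symm]
        exact hg _ (.dJ _ _ _ (validD_symm v)) _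
  have := N.add_mem h1 h2
  simpa using this

/-! ### Products -/

lemma validD_elems {ℓ : ℕ} {I J K : Finset ℕ} (h : validD (Iset ℓ) I J K) :
    (∀ x ∈ I, x ∉ J ∧ x ∉ K) ∧ (∀ x ∈ J, x ∉ K) ∧
    (ℓ + 1 ∉ I ∧ ℓ + 1 ∉ J ∧ ℓ + 1 ∉ K) ∧ (∀ x, x ∈ Iset ℓ ↔ x ∈ I ∨ x ∈ J ∨ x ∈ K) ∧
    (∃ z, z ∈ I) ∧ ∃ x y, x ≠ y ∧ (x ∈ J ∨ x ∈ K) ∧ (y ∈ J ∨ y ∈ K) := by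
  obtain ⟨a, b, c, d, e⟩ := h
  have hm : ∀ x, x ∈ Iset ℓ ↔ x ∈ I ∨ x ∈ J ∨ x ∈ K := by
    intro x; rw [← c, Finset.mem_union, Finset.mem_union]
  have hn : ¬ (ℓ + 1 ∈ Iset ℓ) := by simp
  rw [hm] at hn
  push Not at hn
  obtain ⟨x, hx, y, hy, hxy⟩ := Finset.one_lt_card.1 (show 1 < (J ∪ K).card by omega)
  refine ⟨?_, fun x hx => Finset.disjoint_left.1 b hx, hn, hm, Finset.card_pos.1 (by omega), x, y, hxy,
    Finset.mem_union.1 hx, Finset.mem_union.1 hy⟩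
  intro x hx
  have := Finset.disjoint_left.1 a hx
  rw [Finset.mem_union] at this
  push Not at this
  exact this

lemma validE_elems {ℓ : ℕ} (hℓ : 2 ≤ ℓ) {J K : Finset ℕ} (h : validE (Iset ℓ) J K) :
    (∀ x ∈ J, x ∉ K) ∧ (ℓ + 1 ∉ J ∧ ℓ + 1 ∉ K) ∧ (∀ x, x ∈ Iset ℓ ↔ x ∈ J ∨ x ∈ K) ∧
    (1 ∈ J ∨ 1 ∈ K) ∧ (2 ∈ J ∨ 2 ∈ K) := by
  obtain ⟨b, c⟩ := h
  have hm : ∀ x, x ∈ Iset ℓ ↔ x ∈ J ∨ x ∈ K := by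
    intro x; rw [← c, Finset.mem_union]
  have hn : ¬ (ℓ + 1 ∈ Iset ℓ) := by simp
  rw [hm] at hn
  push Not at hn
  refine ⟨fun x hx => Finset.disjoint_left.1 b hx, hn, hm, ?_, ?_⟩
  · rw [← hm]; simp; omega
  · rw [← hm]; simp; omega

lemma DDM {R : Type} [CommRing R] {ℓ : ℕ} (I J K I' J' K' : Finset ℕ)
    (h : ¬ preceq J K J' K' ∧ ¬ preceq J' K' J K ∧ ¬ J ∪ K ⊆ I') :
    reD R (Iset (ℓ + 1)) I J K * reD R (Iset (ℓ + 1)) I' J' K' ∈ subM R ℓ :=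
  subM_ideal _ _ (DD_mem _ _ _ _ _ _ _ _ h.1 h.2.1 h.2.2)

lemma DEM {R : Type} [CommRing R] {ℓ : ℕ} (J K I' J' K' : Finset ℕ)
    (h : ¬ preceq J' K' J K) :
    reD R (Iset (ℓ + 1)) I' J' K' * reE R (Iset (ℓ + 1)) J K ∈ subM R ℓ := by
  rw [mul_comm]
  exact subM_ideal _ _ (ED_mem _ _ _ _ _ _ _ h)

/-- `v` times each of the three lifts is in the submodule. -/
def All3 (R : Type) [CommRing R] (ℓ : ℕ) (v : RRing R (Iset (ℓ + 1))) (I J K : Finset ℕ) :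
    Prop :=
  v * reD R (Iset (ℓ + 1)) (I ∪ {ℓ + 1}) J K ∈ subM R ℓ ∧
  v * reD R (Iset (ℓ + 1)) I (J ∪ {ℓ + 1}) K ∈ subM R ℓ ∧
  v * reD R (Iset (ℓ + 1)) I J (K ∪ {ℓ + 1}) ∈ subM R ℓ

lemma All3.symm {R : Type} [CommRing R] {ℓ : ℕ} {v : RRing R (Iset (ℓ + 1))}
    {I J K : Finset ℕ} (h : All3 R ℓ v I J K) : All3 R ℓ v I K J := by
  obtain ⟨a, b, c⟩ := h
  rw [reD_symm] at a b c
  exact ⟨a, c, b⟩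

lemma row3 {R : Type} [CommRing R] {ℓ : ℕ} {v : RRing R (Iset (ℓ + 1))} (hv : v ∈ subM R ℓ)
    {I J K : Finset ℕ} (h : validD (Iset ℓ) I J K)
    (H : (v * reD R (Iset (ℓ + 1)) (I ∪ {ℓ + 1}) J K ∈ subM R ℓ ∧
        v * reD R (Iset (ℓ + 1)) I (J ∪ {ℓ + 1}) K ∈ subM R ℓ) ∨
      (v * reD R (Iset (ℓ + 1)) (I ∪ {ℓ + 1}) J K ∈ subM R ℓ ∧
        v * reD R (Iset (ℓ + 1)) I J (K ∪ {ℓ + 1}) ∈ subM R ℓ) ∨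
      (v * reD R (Iset (ℓ + 1)) I (J ∪ {ℓ + 1}) K ∈ subM R ℓ ∧
        v * reD R (Iset (ℓ + 1)) I J (K ∪ {ℓ + 1}) ∈ subM R ℓ)) : All3 R ℓ v I J K := by
  obtain ⟨x, hx⟩ := rowD R ℓ h
  have := subM_mulF R ℓ x hv
  rw [hx, mul_add, mul_add] at this
  unfold All3
  rcases H with ⟨a, b⟩ | ⟨a, b⟩ | ⟨a, b⟩
  · exact ⟨a, b, (AddSubgroup.add_mem_cancel_left _ (add_mem a b)).1 this⟩
  · refine ⟨a, ?_, b⟩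
    exact (AddSubgroup.add_mem_cancel_left _ a).1
      ((AddSubgroup.add_mem_cancel_right _ b).1 this)
  · refine ⟨?_, a, b⟩
    exact (AddSubgroup.add_mem_cancel_right _ a).1
      ((AddSubgroup.add_mem_cancel_right _ b).1 this)

lemma row2 {R : Type} [CommRing R] {ℓ : ℕ} {v : RRing R (Iset (ℓ + 1))} (hv : v ∈ subM R ℓ)
    {J K : Finset ℕ} (h : validE (Iset ℓ) J K)
    (H : v * reE R (Iset (ℓ + 1)) (J ∪ {ℓ + 1}) K ∈ subM R ℓ ∨
      v * reE R (Iset (ℓ + 1)) J (K ∪ {ℓ + 1}) ∈ subM R ℓ) :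
    v * reE R (Iset (ℓ + 1)) (J ∪ {ℓ + 1}) K ∈ subM R ℓ ∧
      v * reE R (Iset (ℓ + 1)) J (K ∪ {ℓ + 1}) ∈ subM R ℓ := by
  obtain ⟨x, hx⟩ := rowE R ℓ h
  have := subM_mulF R ℓ x hv
  rw [hx, mul_add] at this
  rcases H with a | a
  · exact ⟨a, (AddSubgroup.add_mem_cancel_left _ a).1 this⟩
  · exact ⟨(AddSubgroup.add_mem_cancel_right _ a).1 this, a⟩

lemma casesD {ℓ : ℕ} {I J K : Finset ℕ} (h : validD (Iset (ℓ + 1)) I J K) :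
    (I = {ℓ + 1} ∧ validE (Iset ℓ) J K) ∨
    (∃ I₀, I = I₀ ∪ {ℓ + 1} ∧ validD (Iset ℓ) I₀ J K) ∨
    (∃ J₀, J = J₀ ∪ {ℓ + 1} ∧ validD (Iset ℓ) I J₀ K) ∨
    (∃ K₀, K = K₀ ∪ {ℓ + 1} ∧ validD (Iset ℓ) I J K₀) ∨
    (∃ i ∈ Iset ℓ, I = Iset ℓ \ {i} ∧
      ((J = {i, ℓ + 1} ∧ K = ∅) ∨ (J = ∅ ∧ K = {i, ℓ + 1}) ∨
       (J = {i} ∧ K = {ℓ + 1}) ∨ (J = {ℓ + 1} ∧ K = {i}))) := by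
  obtain ⟨a, b, c, d, e⟩ := h
  have hS : Iset (ℓ + 1) = Iset ℓ ∪ {ℓ + 1} := by
    ext x; simp only [Iset, Finset.mem_Icc, Finset.mem_union, Finset.mem_singleton]; omega
  have hn : ℓ + 1 ∉ Iset ℓ := by simp
  have hm : ∀ x, x ∈ Iset ℓ ∨ x = ℓ + 1 ↔ x ∈ I ∨ x ∈ J ∨ x ∈ K := by
    intro x
    rw [← Finset.mem_union (s := J), ← Finset.mem_union (s := I), c, hS, Finset.mem_union, Finset.mem_singleton]
  have hdi : ∀ x ∈ I, x ∉ J ∧ x ∉ K := by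
    intro x hx
    have := Finset.disjoint_left.1 a hx
    rw [Finset.mem_union] at this
    push Not at this
    exact this
  have hdj : ∀ x ∈ J, x ∉ K := fun x hx => Finset.disjoint_left.1 b hx
  generalize Iset ℓ = T at *
  generalize ℓ + 1 = n at *
  have hnn := (hm n).1 (Or.inr rfl)
  by_cases hI : n ∈ I
  · by_cases hI1 : I = {n}
    · left
      refine ⟨hI1, b, ?_⟩
      ext x
      have := hm x
      grind
    · right; left
      refine ⟨I.erase n, ?_, ?_, b, ?_, ?_, e⟩
      · ext x; grind
      · rw [Finset.disjoint_left]; grind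
      · ext x; have := hm x; grind
      · rw [Finset.one_le_card]
        by_contra hne
        rw [Finset.not_nonempty_iff_eq_empty] at hne
        apply hI1
        ext x
        have : x ∉ I.erase n := by rw [hne]; simp
        grind
  · by_cases h2 : (J ∪ K).card = 2
    · have hnJK : n ∈ J ∪ K := by grind
      obtain ⟨i, hi⟩ : ∃ i, (J ∪ K).erase n = {i} := by
        rw [← Finset.card_eq_one, Finset.card_erase_of_mem hnJK, h2]
      have hi' : ∀ x, (x ≠ n ∧ (x ∈ J ∨ x ∈ K)) ↔ x = i := by
        intro x
        rw [← Finset.mem_union, ← Finset.mem_erase, hi, Finset.mem_singleton]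
      have hii := (hi' i).2 rfl
      right; right; right; right
      refine ⟨i, ?_, ?_, ?_⟩
      · have := hm i; grind
      · ext x; have := hm x; have := hi' x; grind
      · by_cases q1 : n ∈ J <;> by_cases q2 : i ∈ J
        · left
          constructor
          · ext x; have := hi' x; grind
          · ext x; have := hi' x; grind
        · right; right; right
          constructor
          · ext x; have := hi' x; grind
          · ext x; have := hi' x; grind
        · right; right; left
          constructor
          · ext x; have := hi' x; grind
          · ext x; have := hi' x; grind
        · right; left
          constructor
          · ext x; have := hi' x; grind
          · ext x; have := hi' x; grind
    · have h3 : 3 ≤ (J ∪ K).card := by omega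
      rcases hnn with h | hJ | hK
      · exact absurd h hI
      · right; right; left
        have e1 : J.erase n ∪ K = (J ∪ K).erase n := by
          ext x; grind
        refine ⟨J.erase n, ?_, ?_, ?_, ?_, d, ?_⟩
        · ext x; grind
        · rw [Finset.disjoint_left]; grind
        · rw [Finset.disjoint_left]; grind
        · ext x; have := hm x; grind
        · rw [e1, Finset.card_erase_of_mem (by grind)]; omega
      · right; right; right; left
        have e1 : J ∪ K.erase n = (J ∪ K).erase n := by
          ext x; grind
        refine ⟨K.erase n, ?_, ?_, ?_, ?_, d, ?_⟩
        · ext x; grind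
        · rw [Finset.disjoint_left]; grind
        · rw [Finset.disjoint_left]; grind
        · ext x; have := hm x; grind
        · rw [e1, Finset.card_erase_of_mem (by grind)]; omega

/-- All `ℝD` variables lie in the submodule. -/
lemma D_i0_mem (R : Type) [CommRing R] (ℓ : ℕ) (hℓ : 2 ≤ ℓ) (i : ℕ) (hi : i ∈ Iset ℓ) :
    reD R (Iset (ℓ + 1)) (Iset ℓ \ {i}) {i, ℓ + 1} ∅ ∈ subM R ℓ := by
  by_cases h1 : i = 1
  · subst h1; exact subM_s R ℓ
  have hn : ℓ + 1 ∉ Iset ℓ := by simp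
  have h1m : 1 ∈ Iset ℓ := by simp; omega
  have hlt : i ≠ ℓ + 1 := fun h => hn (h ▸ hi)
  by_cases v : validD (Iset (ℓ + 1)) (Iset ℓ \ {i}) {i, ℓ + 1} ∅
  swap
  · rw [reD_invalid _ _ _ _ _ v]; exact zero_mem _
  refine rel_extract R (Iset (ℓ + 1)) (ℓ + 1) i 1 (subM R ℓ) ?_ _ _ _ v ?_ ?_
  · apply subM_ideal
    apply Ideal.subset_span
    right
    refine ⟨ℓ + 1, i, 1, ?_, ?_, ?_, hlt.symm, ?_, h1, rfl⟩
    · simp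
    · simp at hi ⊢; omega
    · simp
    · omega
  · left; grind
  · intro I J K hv hc hne
    rcases casesD hv with ⟨rfl, h⟩ | ⟨I₀, rfl, h⟩ | ⟨J₀, rfl, h⟩ | ⟨K₀, rfl, h⟩ |
      ⟨j, hj, rfl, h⟩
    · exact subM_e0' R ℓ hℓ h
    · exact (subM_d' R ℓ h).1
    · exact (subM_d' R ℓ h).2.1
    · exact (subM_d' R ℓ h).2.2
    · have hj1 : j = 1 ∧ J = {1, ℓ + 1} ∧ K = ∅ := by
        unfold condE at hc
        grind
      obtain ⟨rfl, rfl, rfl⟩ := hj1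
      exact subM_s R ℓ

lemma D_im_mem (R : Type) [CommRing R] (ℓ : ℕ) (hℓ : 2 ≤ ℓ) (i : ℕ) (hi : i ∈ Iset ℓ) :
    reD R (Iset (ℓ + 1)) (Iset ℓ \ {i}) {i} {ℓ + 1} ∈ subM R ℓ := by
  obtain ⟨a, ha, hai⟩ : ∃ a ∈ Iset ℓ, a ≠ i := by
    by_cases h : i = 1
    · exact ⟨2, by simp; omega, by omega⟩
    · exact ⟨1, by simp; omega, by omega⟩
  have hn : ℓ + 1 ∉ Iset ℓ := by simp
  have hlt : i ≠ ℓ + 1 := fun h => hn (h ▸ hi)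
  have hlt' : a ≠ ℓ + 1 := fun h => hn (h ▸ ha)
  by_cases v : validD (Iset (ℓ + 1)) (Iset ℓ \ {i}) {i} {ℓ + 1}
  swap
  · rw [reD_invalid _ _ _ _ _ v]; exact zero_mem _
  refine rel_extract R (Iset (ℓ + 1)) a i (ℓ + 1) (subM R ℓ) ?_ _ _ _ v ?_ ?_
  · apply subM_ideal
    apply Ideal.subset_span
    right
    refine ⟨a, i, ℓ + 1, ?_, ?_, ?_, hai, hlt', hlt, rfl⟩
    · simp at ha ⊢; omega
    · simp at hi ⊢; omega
    · simp
  · right; right; grind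
  · intro I J K hv hc hne
    rcases casesD hv with ⟨rfl, h⟩ | ⟨I₀, rfl, h⟩ | ⟨J₀, rfl, h⟩ | ⟨K₀, rfl, h⟩ |
      ⟨j, hj, rfl, h⟩
    · exact subM_e0' R ℓ hℓ h
    · exact (subM_d' R ℓ h).1
    · exact (subM_d' R ℓ h).2.1
    · exact (subM_d' R ℓ h).2.2
    · have hj1 : j = a ∧ J = {a, ℓ + 1} ∧ K = ∅ := by
        unfold condE at hc
        grind
      obtain ⟨rfl, rfl, rfl⟩ := hj1
      exact D_i0_mem R ℓ hℓ j hj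

set_option linter.unusedSimpArgs false

/-- `D_i^0 · γ^*`. -/
lemma prod_i0_d (R : Type) [CommRing R] (ℓ : ℕ) (hℓ : 2 ≤ ℓ) (i : ℕ) (hi : i ∈ Iset ℓ)
    {I J K : Finset ℕ} (h : validD (Iset ℓ) I J K) :
    All3 R ℓ (reD R (Iset (ℓ + 1)) (Iset ℓ \ {i}) {i, ℓ + 1} ∅) I J K := by
  apply row3 (D_i0_mem R ℓ hℓ i hi) h
  obtain ⟨h1, h2, h3, h4, ⟨z, hz⟩, x, y, hxy, hx, hy⟩ := validD_elems h
  have hii := (h4 i).1 hi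
  have hn : i ≠ ℓ + 1 := by rintro rfl; simp at hi
  rcases hii with hii | hii | hii
  · right; right
    refine ⟨DDM _ _ _ _ _ _ ?_, DDM _ _ _ _ _ _ ?_⟩ <;>
    clear h <;>
    simp only [preceq, Finset.subset_iff, Finset.mem_union, Finset.mem_insert,
        Finset.mem_singleton, Finset.notMem_empty, or_imp,
        forall_and, forall_eq] <;>
    grind
  · right; left
    refine ⟨DDM _ _ _ _ _ _ ?_, DDM _ _ _ _ _ _ ?_⟩ <;>
    clear h <;>
    simp only [preceq, Finset.subset_iff, Finset.mem_union, Finset.mem_insert,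
        Finset.mem_singleton, Finset.notMem_empty, or_imp,
        forall_and, forall_eq] <;>
    grind
  · left
    refine ⟨DDM _ _ _ _ _ _ ?_, DDM _ _ _ _ _ _ ?_⟩ <;>
    clear h <;>
    simp only [preceq, Finset.subset_iff, Finset.mem_union, Finset.mem_insert,
        Finset.mem_singleton, Finset.notMem_empty, or_imp,
        forall_and, forall_eq] <;>
    grind

/-- `D_i^- · γ^*`. -/
lemma prod_im_d (R : Type) [CommRing R] (ℓ : ℕ) (hℓ : 2 ≤ ℓ) (i : ℕ) (hi : i ∈ Iset ℓ)
    {I J K : Finset ℕ} (h : validD (Iset ℓ) I J K) :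
    All3 R ℓ (reD R (Iset (ℓ + 1)) (Iset ℓ \ {i}) {i} {ℓ + 1}) I J K := by
  apply row3 (D_im_mem R ℓ hℓ i hi) h
  obtain ⟨h1, h2, h3, h4, ⟨z, hz⟩, x, y, hxy, hx, hy⟩ := validD_elems h
  have hii := (h4 i).1 hi
  have hn : i ≠ ℓ + 1 := by rintro rfl; simp at hi
  rcases hii with hii | hii | hii
  · right; right
    refine ⟨DDM _ _ _ _ _ _ ?_, DDM _ _ _ _ _ _ ?_⟩ <;>
    clear h <;>
    simp only [preceq, Finset.subset_iff, Finset.mem_union, Finset.mem_insert,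
        Finset.mem_singleton, Finset.notMem_empty, or_imp,
        forall_and, forall_eq] <;>
    grind
  · left
    refine ⟨DDM _ _ _ _ _ _ ?_, DDM _ _ _ _ _ _ ?_⟩ <;>
    clear h <;>
    simp only [preceq, Finset.subset_iff, Finset.mem_union, Finset.mem_insert,
        Finset.mem_singleton, Finset.notMem_empty, or_imp,
        forall_and, forall_eq] <;>
    grind
  · right; left
    refine ⟨DDM _ _ _ _ _ _ ?_, DDM _ _ _ _ _ _ ?_⟩ <;>
    clear h <;>
    simp only [preceq, Finset.subset_iff, Finset.mem_union, Finset.mem_insert,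
        Finset.mem_singleton, Finset.notMem_empty, or_imp,
        forall_and, forall_eq] <;>
    grind

/-- `D_i^0 · e^±`. -/
lemma prod_i0_e (R : Type) [CommRing R] (ℓ : ℕ) (hℓ : 2 ≤ ℓ) (i : ℕ) (hi : i ∈ Iset ℓ)
    {J K : Finset ℕ} (h : validE (Iset ℓ) J K) :
    reD R (Iset (ℓ + 1)) (Iset ℓ \ {i}) {i, ℓ + 1} ∅ *
      reE R (Iset (ℓ + 1)) (J ∪ {ℓ + 1}) K ∈ subM R ℓ := by
  refine (row2 (D_i0_mem R ℓ hℓ i hi) h ?_).1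
  obtain ⟨h2, h3, h4, -⟩ := validE_elems hℓ h
  have hii := (h4 i).1 hi
  have hn : i ≠ ℓ + 1 := by rintro rfl; simp at hi
  rcases hii with hii | hii
  · right
    refine DEM _ _ _ _ _ ?_
    simp only [preceq, Finset.subset_iff, Finset.mem_union, Finset.mem_insert,
        Finset.mem_singleton, Finset.notMem_empty, or_imp,
        forall_and, forall_eq]
    grind
  · left
    refine DEM _ _ _ _ _ ?_
    simp only [preceq, Finset.subset_iff, Finset.mem_union, Finset.mem_insert,
        Finset.mem_singleton, Finset.notMem_empty, or_imp,
        forall_and, forall_eq]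
    grind

/-- `D_i^- · e^±`. -/
lemma prod_im_e (R : Type) [CommRing R] (ℓ : ℕ) (hℓ : 2 ≤ ℓ) (i : ℕ) (hi : i ∈ Iset ℓ)
    {J K : Finset ℕ} (h : validE (Iset ℓ) J K) :
    reD R (Iset (ℓ + 1)) (Iset ℓ \ {i}) {i} {ℓ + 1} *
      reE R (Iset (ℓ + 1)) (J ∪ {ℓ + 1}) K ∈ subM R ℓ := by
  refine (row2 (D_im_mem R ℓ hℓ i hi) h ?_).1
  obtain ⟨h2, h3, h4, -⟩ := validE_elems hℓ h
  have hii := (h4 i).1 hi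
  have hn : i ≠ ℓ + 1 := by rintro rfl; simp at hi
  rcases hii with hii | hii
  · left
    refine DEM _ _ _ _ _ ?_
    simp only [preceq, Finset.subset_iff, Finset.mem_union, Finset.mem_insert,
        Finset.mem_singleton, Finset.notMem_empty, or_imp,
        forall_and, forall_eq]
    grind
  · right
    refine DEM _ _ _ _ _ ?_
    simp only [preceq, Finset.subset_iff, Finset.mem_union, Finset.mem_insert,
        Finset.mem_singleton, Finset.notMem_empty, or_imp,
        forall_and, forall_eq]
    grind

/-- `D_i^0 · e^0`. -/
lemma prod_i0_e0 (R : Type) [CommRing R] (ℓ : ℕ) (hℓ : 2 ≤ ℓ) (i : ℕ) (hi : i ∈ Iset ℓ)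
    {J K : Finset ℕ} (h : validE (Iset ℓ) J K) :
    reD R (Iset (ℓ + 1)) (Iset ℓ \ {i}) {i, ℓ + 1} ∅ *
      reD R (Iset (ℓ + 1)) {ℓ + 1} J K ∈ subM R ℓ := by
  obtain ⟨h2, h3, h4, h5, h6⟩ := validE_elems hℓ h
  have hn : i ≠ ℓ + 1 := by rintro rfl; simp at hi
  have n1 : 1 ≠ ℓ + 1 := by omega
  have n2 : 2 ≠ ℓ + 1 := by omega
  refine DDM _ _ _ _ _ _ ?_
  simp only [preceq, Finset.subset_iff, Finset.mem_union, Finset.mem_insert,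
        Finset.mem_singleton, Finset.notMem_empty, or_imp,
        forall_and, forall_eq]
  grind

/-- `D_i^- · e^0`. -/
lemma prod_im_e0 (R : Type) [CommRing R] (ℓ : ℕ) (hℓ : 2 ≤ ℓ) (i : ℕ) (hi : i ∈ Iset ℓ)
    {J K : Finset ℕ} (h : validE (Iset ℓ) J K) :
    reD R (Iset (ℓ + 1)) (Iset ℓ \ {i}) {i} {ℓ + 1} *
      reD R (Iset (ℓ + 1)) {ℓ + 1} J K ∈ subM R ℓ := by
  obtain ⟨h2, h3, h4, h5, h6⟩ := validE_elems hℓ h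
  have hn : i ≠ ℓ + 1 := by rintro rfl; simp at hi
  have n1 : 1 ≠ ℓ + 1 := by omega
  have n2 : 2 ≠ ℓ + 1 := by omega
  refine DDM _ _ _ _ _ _ ?_
  simp only [preceq, Finset.subset_iff, Finset.mem_union, Finset.mem_insert,
        Finset.mem_singleton, Finset.notMem_empty, or_imp,
        forall_and, forall_eq]
  grind

/-- `e^0 · γ^*`. -/
lemma prod_e0_d (R : Type) [CommRing R] (ℓ : ℕ) (hℓ : 2 ≤ ℓ)
    {J' K' : Finset ℕ} (h' : validE (Iset ℓ) J' K')
    {I J K : Finset ℕ} (h : validD (Iset ℓ) I J K) :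
    All3 R ℓ (reD R (Iset (ℓ + 1)) {ℓ + 1} J' K') I J K := by
  apply row3 (subM_e0' R ℓ hℓ h') h
  obtain ⟨h1, h2, h3, h4, ⟨z, hz⟩, x, y, hxy, hx, hy⟩ := validD_elems h
  obtain ⟨h2', h3', h4', h5, h6⟩ := validE_elems hℓ h'
  have hz' := h4' z
  have hz4 := h4 z
  have hx' := h4' x
  have hx4 := h4 x
  right; right
  refine ⟨DDM _ _ _ _ _ _ ?_, DDM _ _ _ _ _ _ ?_⟩ <;>
    clear h <;>
    simp only [preceq, Finset.subset_iff, Finset.mem_union, Finset.mem_insert,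
        Finset.mem_singleton, Finset.notMem_empty, or_imp,
        forall_and, forall_eq] <;>
    grind

/-- `γ^* · e^±`, first version. -/
lemma prod_ep_d (R : Type) [CommRing R] (ℓ : ℕ) (hℓ : 2 ≤ ℓ)
    {J' K' : Finset ℕ} (h' : validE (Iset ℓ) J' K')
    {I J K : Finset ℕ} (h : validD (Iset ℓ) I J K) :
    All3 R ℓ (reE R (Iset (ℓ + 1)) (J' ∪ {ℓ + 1}) K') I J K := by
  apply row3 (subM_ep' R ℓ hℓ h') h
  obtain ⟨h1, h2, h3, h4, ⟨z, hz⟩, x, y, hxy, hx, hy⟩ := validD_elems h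
  obtain ⟨h2', h3', h4', h5, h6⟩ := validE_elems hℓ h'
  obtain ⟨-, mJ, mK⟩ := subM_d' R ℓ h
  right; right
  rw [mul_comm (reE _ _ _ _), mul_comm (reE _ _ _ _)]
  refine ⟨(row2 mJ h' ?_).1, (row2 mK h' ?_).1⟩
  · by_cases q : preceq (J ∪ {ℓ + 1}) K (J' ∪ {ℓ + 1}) K'
    · right
      refine DEM _ _ _ _ _ ?_
      simp only [preceq, Finset.subset_iff, Finset.mem_union, Finset.mem_insert,
        Finset.mem_singleton, Finset.notMem_empty, or_imp,
        forall_and, forall_eq] at q ⊢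
      grind
    · left; exact DEM _ _ _ _ _ q
  · by_cases q : preceq J (K ∪ {ℓ + 1}) (J' ∪ {ℓ + 1}) K'
    · right
      refine DEM _ _ _ _ _ ?_
      simp only [preceq, Finset.subset_iff, Finset.mem_union, Finset.mem_insert,
        Finset.mem_singleton, Finset.notMem_empty, or_imp,
        forall_and, forall_eq] at q ⊢
      grind
    · left; exact DEM _ _ _ _ _ q

set_option linter.unusedSimpArgs false

lemma All3.comm {R : Type} [CommRing R] {ℓ : ℕ} {I J K I' J' K' : Finset ℕ}
    (h1 : All3 R ℓ (reD R (Iset (ℓ + 1)) (I ∪ {ℓ + 1}) J K) I' J' K')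
    (h2 : All3 R ℓ (reD R (Iset (ℓ + 1)) I (J ∪ {ℓ + 1}) K) I' J' K')
    (h3 : All3 R ℓ (reD R (Iset (ℓ + 1)) I J (K ∪ {ℓ + 1})) I' J' K') :
    All3 R ℓ (reD R (Iset (ℓ + 1)) (I' ∪ {ℓ + 1}) J' K') I J K ∧
    All3 R ℓ (reD R (Iset (ℓ + 1)) I' (J' ∪ {ℓ + 1}) K') I J K ∧
    All3 R ℓ (reD R (Iset (ℓ + 1)) I' J' (K' ∪ {ℓ + 1})) I J K := by
  unfold All3 at *
  simp only [mul_comm (reD R _ I' _ _), mul_comm (reD R _ (I' ∪ _) _ _)]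
  exact ⟨⟨h1.1, h2.1, h3.1⟩, ⟨h1.2.1, h2.2.1, h3.2.1⟩, ⟨h1.2.2, h2.2.2, h3.2.2⟩⟩

/-- `γ^* · δ^*` when `δ` is not nested in `γ`. -/
lemma prod_dd_aux (R : Type) [CommRing R] (ℓ : ℕ)
    {I J K I' J' K' : Finset ℕ} (h : validD (Iset ℓ) I J K) (h' : validD (Iset ℓ) I' J' K')
    (hp : ¬ preceq J' K' J K) :
    All3 R ℓ (reD R (Iset (ℓ + 1)) (I ∪ {ℓ + 1}) J K) I' J' K' ∧
    All3 R ℓ (reD R (Iset (ℓ + 1)) I (J ∪ {ℓ + 1}) K) I' J' K' ∧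
    All3 R ℓ (reD R (Iset (ℓ + 1)) I J (K ∪ {ℓ + 1})) I' J' K' := by
  have gJK : All3 R ℓ (reD R (Iset (ℓ + 1)) I (J ∪ {ℓ + 1}) K) I' J' K' ∧
      All3 R ℓ (reD R (Iset (ℓ + 1)) I J (K ∪ {ℓ + 1})) I' J' K' := by
    obtain ⟨h1, h2, h3, h4, ⟨z, hz⟩, x, y, hxy, hx, hy⟩ := validD_elems h
    obtain ⟨h1', h2', h3', h4', ⟨z', hz'⟩, x', y', hxy', hx', hy'⟩ := validD_elems h'
    have r2 := subM_d' R ℓ h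
    by_cases qA : J ⊆ J' ∧ K ⊆ K'
    · refine ⟨row3 r2.2.1 h' (Or.inr (Or.inl ⟨DDM _ _ _ _ _ _ ?_, DDM _ _ _ _ _ _ ?_⟩)),
        row3 r2.2.2 h' (Or.inl ⟨DDM _ _ _ _ _ _ ?_, DDM _ _ _ _ _ _ ?_⟩)⟩ <;>
      clear h h' r2 <;> revert hp qA <;>
      simp only [preceq, Finset.subset_iff, Finset.mem_union, Finset.mem_insert,
        Finset.mem_singleton, Finset.notMem_empty, or_imp, forall_and, forall_eq] <;>
      grind
    by_cases qB : J ⊆ K' ∧ K ⊆ J'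
    · refine ⟨row3 r2.2.1 h' (Or.inl ⟨DDM _ _ _ _ _ _ ?_, DDM _ _ _ _ _ _ ?_⟩),
        row3 r2.2.2 h' (Or.inr (Or.inl ⟨DDM _ _ _ _ _ _ ?_, DDM _ _ _ _ _ _ ?_⟩))⟩ <;>
      clear h h' r2 <;> revert hp qA qB <;>
      simp only [preceq, Finset.subset_iff, Finset.mem_union, Finset.mem_insert,
        Finset.mem_singleton, Finset.notMem_empty, or_imp, forall_and, forall_eq] <;>
      grind
    · refine ⟨row3 r2.2.1 h' (Or.inr (Or.inr ⟨DDM _ _ _ _ _ _ ?_, DDM _ _ _ _ _ _ ?_⟩)),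
        row3 r2.2.2 h' (Or.inr (Or.inr ⟨DDM _ _ _ _ _ _ ?_, DDM _ _ _ _ _ _ ?_⟩))⟩ <;>
      clear h h' r2 <;> revert hp qA qB <;>
      simp only [preceq, Finset.subset_iff, Finset.mem_union, Finset.mem_insert,
        Finset.mem_singleton, Finset.notMem_empty, or_imp, forall_and, forall_eq] <;>
      grind
  obtain ⟨gJ, gK⟩ := gJK
  refine ⟨?_, gJ, gK⟩
  obtain ⟨m1, m2, m3⟩ := subM_d' R ℓ h'
  have c1 := row3 m1 h (Or.inr (Or.inr ⟨by rw [mul_comm]; exact gJ.1, by rw [mul_comm]; exact gK.1⟩))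
  have c2 := row3 m2 h
    (Or.inr (Or.inr ⟨by rw [mul_comm]; exact gJ.2.1, by rw [mul_comm]; exact gK.2.1⟩))
  have c3 := row3 m3 h
    (Or.inr (Or.inr ⟨by rw [mul_comm]; exact gJ.2.2, by rw [mul_comm]; exact gK.2.2⟩))
  exact (All3.comm c1 c2 c3).1

/-- Mutually nested elements coincide. -/
lemma eq_of_preceq {ℓ : ℕ} {I J K I' J' K' : Finset ℕ}
    (h : validD (Iset ℓ) I J K) (h' : validD (Iset ℓ) I' J' K')
    (q1 : preceq J' K' J K) (q2 : preceq J K J' K') :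
    I' = I ∧ ((J' = J ∧ K' = K) ∨ (J' = K ∧ K' = J)) := by
  obtain ⟨h1, h2, -, h4, -, x, y, -, hx, -⟩ := validD_elems h
  obtain ⟨h1', -, -, h4', -, -⟩ := validD_elems h'
  have hI : ∀ w, (w ∈ J' ∨ w ∈ K' ↔ w ∈ J ∨ w ∈ K) → (w ∈ I' ↔ w ∈ I) := by
    intro w hw
    have e : (w ∈ I' ∨ w ∈ J' ∨ w ∈ K') ↔ (w ∈ I ∨ w ∈ J ∨ w ∈ K) := by
      rw [← h4, ← h4']
    constructor
    · intro hi
      rcases e.1 (Or.inl hi) with g | g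
      · exact g
      · rcases hw.2 g with g | g
        · exact absurd g (h1' w hi).1
        · exact absurd g (h1' w hi).2
    · intro hi
      rcases e.2 (Or.inl hi) with g | g
      · exact g
      · rcases hw.1 g with g | g
        · exact absurd g (h1 w hi).1
        · exact absurd g (h1 w hi).2
  rcases q1 with q1 | q1 <;> rcases q2 with q2 | q2
  · have e1 := q1.1.antisymm q2.1
    have e2 := q1.2.antisymm q2.2
    exact ⟨Finset.ext fun w => hI w (by rw [e1, e2]), Or.inl ⟨e1, e2⟩⟩
  · exfalso
    rcases hx with hx | hx
    · exact h2 x hx (q1.2 (q2.1 hx))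
    · exact h2 x (q1.1 (q2.2 hx)) hx
  · exfalso
    rcases hx with hx | hx
    · exact h2 x hx (q1.1 (q2.1 hx))
    · exact h2 x (q1.2 (q2.2 hx)) hx
  · have e1 := q1.1.antisymm q2.2
    have e2 := q1.2.antisymm q2.1
    exact ⟨Finset.ext fun w => hI w (by rw [e1, e2, or_comm]), Or.inr ⟨e1, e2⟩⟩

/-- `γ^I · δ^*` for `δ ≠ γ`. -/
lemma prod_dd_ne (R : Type) [CommRing R] (ℓ : ℕ)
    {I J K I' J' K' : Finset ℕ} (h : validD (Iset ℓ) I J K) (h' : validD (Iset ℓ) I' J' K')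
    (hne : ¬ (I' = I ∧ ((J' = J ∧ K' = K) ∨ (J' = K ∧ K' = J)))) :
    All3 R ℓ (reD R (Iset (ℓ + 1)) (I ∪ {ℓ + 1}) J K) I' J' K' ∧
    All3 R ℓ (reD R (Iset (ℓ + 1)) I (J ∪ {ℓ + 1}) K) I' J' K' ∧
    All3 R ℓ (reD R (Iset (ℓ + 1)) I J (K ∪ {ℓ + 1})) I' J' K' := by
  by_cases q1 : preceq J' K' J K
  · by_cases q2 : preceq J K J' K'
    · exact absurd (eq_of_preceq h h' q1 q2) hne
    · have t := prod_dd_aux R ℓ h' h q2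
      exact All3.comm t.1 t.2.1 t.2.2
  · exact prod_dd_aux R ℓ h h' q1

lemma relE_mem (R : Type) [CommRing R] (ℓ : ℕ) {a b c : ℕ} (ha : a ∈ Iset (ℓ + 1))
    (hb : b ∈ Iset (ℓ + 1)) (hc : c ∈ Iset (ℓ + 1)) (hab : a ≠ b) (hac : a ≠ c) (hbc : b ≠ c) :
    relE R (Iset (ℓ + 1)) a b c ∈ reIdeal R (Iset (ℓ + 1)) :=
  Ideal.subset_span (Or.inr ⟨a, b, c, ha, hb, hc, hab, hac, hbc, rfl⟩)

/-- The additive subgroup of `p` with `v * p` in the submodule. -/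
def subN (R : Type) [CommRing R] (ℓ : ℕ) (v : RRing R (Iset (ℓ + 1))) :
    AddSubgroup (RRing R (Iset (ℓ + 1))) :=
  (subM R ℓ).comap (AddMonoidHom.mulLeft v)

lemma mem_subN {R : Type} [CommRing R] {ℓ : ℕ} {v p : RRing R (Iset (ℓ + 1))} :
    p ∈ subN R ℓ v ↔ v * p ∈ subM R ℓ := Iff.rfl

lemma subN_ideal {R : Type} [CommRing R] {ℓ : ℕ} (v : RRing R (Iset (ℓ + 1)))
    {p} (hp : p ∈ reIdeal R (Iset (ℓ + 1))) : p ∈ subN R ℓ v :=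
  mem_subN.2 (subM_ideal _ _ (Ideal.mul_mem_left _ _ hp))

lemma mem_Iset_succ {ℓ x : ℕ} (h : x ∈ Iset ℓ) : x ∈ Iset (ℓ + 1) := by
  simp at h ⊢; omega

lemma succ_mem_Iset (ℓ : ℕ) : ℓ + 1 ∈ Iset (ℓ + 1) := by simp

lemma ne_succ_of_mem {ℓ x : ℕ} (h : x ∈ Iset ℓ) : x ≠ ℓ + 1 := by
  simp at h; omega

/-- The special variables in the relation, multiplied by `v`. -/
lemma special_mem {R : Type} [CommRing R] {ℓ : ℕ} (N : AddSubgroup (RRing R (Iset (ℓ + 1))))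
    {i : ℕ} {J K : Finset ℕ}
    (h0 : reD R (Iset (ℓ + 1)) (Iset ℓ \ {i}) {i, ℓ + 1} ∅ ∈ N)
    (hm : reD R (Iset (ℓ + 1)) (Iset ℓ \ {i}) {i} {ℓ + 1} ∈ N)
    (h : (J = {i, ℓ + 1} ∧ K = ∅) ∨ (J = ∅ ∧ K = {i, ℓ + 1}) ∨
       (J = {i} ∧ K = {ℓ + 1}) ∨ (J = {ℓ + 1} ∧ K = {i})) :
    reD R (Iset (ℓ + 1)) (Iset ℓ \ {i}) J K ∈ N := by
  rcases h with ⟨rfl, rfl⟩ | ⟨rfl, rfl⟩ | ⟨rfl, rfl⟩ | ⟨rfl, rfl⟩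
  · exact h0
  · rw [reD_symm]; exact h0
  · exact hm
  · rw [reD_symm]; exact hm

/-- `γ^I · γ^*` -/
lemma prod_self_aux (R : Type) [CommRing R] (ℓ : ℕ) (hℓ : 2 ≤ ℓ)
    {I J K : Finset ℕ} (h : validD (Iset ℓ) I J K) {b : ℕ} (hb : b ∈ J) :
    All3 R ℓ (reD R (Iset (ℓ + 1)) (I ∪ {ℓ + 1}) J K) I J K := by
  obtain ⟨h1, h2, h3, h4, ⟨a, ha⟩, -⟩ := validD_elems h
  have mv := (subM_d' R ℓ h).1
  have hbm : b ∈ Iset ℓ := (h4 b).2 (Or.inr (Or.inl hb))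
  have ham : a ∈ Iset ℓ := (h4 a).2 (Or.inl ha)
  have hbn := ne_succ_of_mem hbm
  have han := ne_succ_of_mem ham
  have hab : a ≠ b := by rintro rfl; exact (h1 a ha).1 hb
  apply row3 mv h
  right; right
  constructor
  · by_cases v : validD (Iset (ℓ + 1)) I (J ∪ {ℓ + 1}) K
    swap
    · rw [reD_invalid _ _ _ _ _ v, mul_zero]; exact zero_mem _
    rw [← mem_subN]
    refine rel_extract R _ (ℓ + 1) b a (subN R ℓ _) (subN_ideal _ (relE_mem R ℓ
      (succ_mem_Iset ℓ) (mem_Iset_succ hbm) (mem_Iset_succ ham) hbn.symm han.symm hab.symm))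
      _ _ _ v (Or.inl ⟨by simp, by simp [hb], ha⟩) ?_
    intro I' J' K' hv hc hne
    unfold condE at hc
    rcases casesD hv with ⟨rfl, h'⟩ | ⟨I₀, rfl, h'⟩ | ⟨J₀, rfl, h'⟩ | ⟨K₀, rfl, h'⟩ |
      ⟨j, hj, rfl, h'⟩
    · rw [mem_subN, mul_comm]; exact (prod_e0_d R ℓ hℓ h' h).1
    · refine (prod_dd_ne R ℓ h h' ?_).1.1
      have e := validD_elems h'
      clear hv h h' v mv
      grind
    · refine (prod_dd_ne R ℓ h h' ?_).1.2.1
      have e := validD_elems h'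
      clear hv h h' v mv
      grind
    · refine (prod_dd_ne R ℓ h h' ?_).1.2.2
      have e := validD_elems h'
      clear hv h h' v mv
      grind
    · refine special_mem _ ?_ ?_ h'
      · rw [mem_subN, mul_comm]; exact (prod_i0_d R ℓ hℓ j hj h).1
      · rw [mem_subN, mul_comm]; exact (prod_im_d R ℓ hℓ j hj h).1
  · by_cases v : validD (Iset (ℓ + 1)) I J (K ∪ {ℓ + 1})
    swap
    · rw [reD_invalid _ _ _ _ _ v, mul_zero]; exact zero_mem _
    rw [← mem_subN]
    refine rel_extract R _ a b (ℓ + 1) (subN R ℓ _) (subN_ideal _ (relE_mem R ℓ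
      (mem_Iset_succ ham) (mem_Iset_succ hbm) (succ_mem_Iset ℓ) hab han hbn))
      _ _ _ v (Or.inr (Or.inr ⟨ha, hb, by simp⟩)) ?_
    intro I' J' K' hv hc hne
    unfold condE at hc
    rcases casesD hv with ⟨rfl, h'⟩ | ⟨I₀, rfl, h'⟩ | ⟨J₀, rfl, h'⟩ | ⟨K₀, rfl, h'⟩ |
      ⟨j, hj, rfl, h'⟩
    · rw [mem_subN, mul_comm]; exact (prod_e0_d R ℓ hℓ h' h).1
    · refine (prod_dd_ne R ℓ h h' ?_).1.1
      have e := validD_elems h'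
      clear hv h h' v mv
      grind
    · refine (prod_dd_ne R ℓ h h' ?_).1.2.1
      have e := validD_elems h'
      clear hv h h' v mv
      grind
    · refine (prod_dd_ne R ℓ h h' ?_).1.2.2
      have e := validD_elems h'
      clear hv h h' v mv
      grind
    · refine special_mem _ ?_ ?_ h'
      · rw [mem_subN, mul_comm]; exact (prod_i0_d R ℓ hℓ j hj h).1
      · rw [mem_subN, mul_comm]; exact (prod_im_d R ℓ hℓ j hj h).1

lemma prod_self (R : Type) [CommRing R] (ℓ : ℕ) (hℓ : 2 ≤ ℓ)
    {I J K : Finset ℕ} (h : validD (Iset ℓ) I J K) :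
    All3 R ℓ (reD R (Iset (ℓ + 1)) (I ∪ {ℓ + 1}) J K) I J K ∧
    All3 R ℓ (reD R (Iset (ℓ + 1)) I (J ∪ {ℓ + 1}) K) I J K ∧
    All3 R ℓ (reD R (Iset (ℓ + 1)) I J (K ∪ {ℓ + 1})) I J K := by
  have gI : All3 R ℓ (reD R (Iset (ℓ + 1)) (I ∪ {ℓ + 1}) J K) I J K := by
    obtain ⟨-, -, -, -, -, x, y, -, hx, -⟩ := validD_elems h
    rcases hx with hx | hx
    · exact prod_self_aux R ℓ hℓ h hx
    · rw [reD_symm]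
      exact (prod_self_aux R ℓ hℓ (validD_symm h) hx).symm
  have gJK : reD R (Iset (ℓ + 1)) I (J ∪ {ℓ + 1}) K * reD R (Iset (ℓ + 1)) I J (K ∪ {ℓ + 1})
      ∈ subM R ℓ := by
    apply DDM
    obtain ⟨h1, h2, h3, h4, -, x, y, hxy, hx, hy⟩ := validD_elems h
    clear h
    simp only [preceq, Finset.subset_iff, Finset.mem_union, Finset.mem_insert,
        Finset.mem_singleton, Finset.notMem_empty, or_imp, forall_and, forall_eq]
    grind
  obtain ⟨m1, m2, m3⟩ := subM_d' R ℓ h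
  refine ⟨gI, row3 m2 h (Or.inr (Or.inl ⟨?_, gJK⟩)), row3 m3 h (Or.inl ⟨?_, ?_⟩)⟩
  · rw [mul_comm]; exact gI.2.1
  · rw [mul_comm]; exact gI.2.2
  · rw [mul_comm]; exact gJK

/-- All products of lifts of `ℝD` variables. -/
lemma prod_dd (R : Type) [CommRing R] (ℓ : ℕ) (hℓ : 2 ≤ ℓ)
    {I J K I' J' K' : Finset ℕ} (h : validD (Iset ℓ) I J K) (h' : validD (Iset ℓ) I' J' K') :
    All3 R ℓ (reD R (Iset (ℓ + 1)) (I ∪ {ℓ + 1}) J K) I' J' K' ∧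
    All3 R ℓ (reD R (Iset (ℓ + 1)) I (J ∪ {ℓ + 1}) K) I' J' K' := by
  by_cases q : I' = I ∧ ((J' = J ∧ K' = K) ∨ (J' = K ∧ K' = J))
  · obtain ⟨rfl, ⟨rfl, rfl⟩ | ⟨rfl, rfl⟩⟩ := q
    · have := prod_self R ℓ hℓ h
      exact ⟨this.1, this.2.1⟩
    · have := prod_self R ℓ hℓ h
      exact ⟨this.1.symm, this.2.1.symm⟩
  · have := prod_dd_ne R ℓ h h' q
    exact ⟨this.1, this.2.1⟩

/-- Extraction of `v * e^0`. -/
lemma e0_extract (R : Type) [CommRing R] (ℓ : ℕ) (hℓ : 2 ≤ ℓ) (v : RRing R (Iset (ℓ + 1)))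
    {J K : Finset ℕ} (h : validE (Iset ℓ) J K)
    (H0 : ∀ J' K', validE (Iset ℓ) J' K' → ¬ (J' = J ∧ K' = K) → ¬ (J' = K ∧ K' = J) →
      v * reD R (Iset (ℓ + 1)) {ℓ + 1} J' K' ∈ subM R ℓ)
    (H1 : ∀ I' J' K', validD (Iset ℓ) I' J' K' → All3 R ℓ v I' J' K')
    (H2 : ∀ i ∈ Iset ℓ, v * reD R (Iset (ℓ + 1)) (Iset ℓ \ {i}) {i, ℓ + 1} ∅ ∈ subM R ℓ)
    (H3 : ∀ i ∈ Iset ℓ, v * reD R (Iset (ℓ + 1)) (Iset ℓ \ {i}) {i} {ℓ + 1} ∈ subM R ℓ) :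
    v * reD R (Iset (ℓ + 1)) {ℓ + 1} J K ∈ subM R ℓ := by
  have key : ∀ a b c J K, validE (Iset ℓ) J K → a ∈ Iset (ℓ + 1) → b ∈ Iset (ℓ + 1) →
      c ∈ Iset (ℓ + 1) → a ≠ b → a ≠ c → b ≠ c → condE a b c {ℓ + 1} J K →
      ¬ condE a b c {ℓ + 1} K J →
      (∀ J' K', validE (Iset ℓ) J' K' → ¬ (J' = J ∧ K' = K) → ¬ (J' = K ∧ K' = J) →
        v * reD R (Iset (ℓ + 1)) {ℓ + 1} J' K' ∈ subM R ℓ) →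
      v * reD R (Iset (ℓ + 1)) {ℓ + 1} J K ∈ subM R ℓ := by
    intro a b c J K hE ha hb hc hab hac hbc hcond hncond H0
    by_cases w : validD (Iset (ℓ + 1)) {ℓ + 1} J K
    swap
    · rw [reD_invalid _ _ _ _ _ w, mul_zero]; exact zero_mem _
    rw [← mem_subN]
    refine rel_extract R _ a b c (subN R ℓ _) (subN_ideal _ (relE_mem R ℓ ha hb hc hab hac hbc))
      _ _ _ w hcond ?_
    intro I' J' K' hv hc' hne
    rcases casesD hv with ⟨rfl, h'⟩ | ⟨I₀, rfl, h'⟩ | ⟨J₀, rfl, h'⟩ | ⟨K₀, rfl, h'⟩ |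
      ⟨j, hj, rfl, h'⟩
    · refine H0 _ _ h' (fun e => hne ⟨rfl, e⟩) ?_
      rintro ⟨rfl, rfl⟩
      exact hncond hc'
    · exact (H1 _ _ _ h').1
    · exact (H1 _ _ _ h').2.1
    · exact (H1 _ _ _ h').2.2
    · exact special_mem _ (H2 j hj) (H3 j hj) h'
  obtain ⟨h2, h3, h4, h5, h6⟩ := validE_elems hℓ h
  have m1 : 1 ∈ Iset (ℓ + 1) := by simp
  have m2 : 2 ∈ Iset (ℓ + 1) := by simp; omega
  have mn := succ_mem_Iset ℓ
  have n1 : 1 ≠ ℓ + 1 := by omega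
  have n2 : 2 ≠ ℓ + 1 := by omega
  have h21 := h2 1
  have h22 := h2 2
  have hsym : ∀ J' K', validE (Iset ℓ) J' K' → ¬ (J' = K ∧ K' = J) → ¬ (J' = J ∧ K' = K) →
      v * reD R (Iset (ℓ + 1)) {ℓ + 1} J' K' ∈ subM R ℓ :=
    fun J' K' a b c => H0 J' K' a c b
  rcases h5 with h5 | h5 <;> rcases h6 with h6 | h6
  · exact key 1 2 (ℓ + 1) J K h m1 m2 mn (by omega) n1 n2 (Or.inl ⟨h5, h6, by simp⟩)
      (by unfold condE; simp only [Finset.mem_singleton]; tauto) H0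
  · exact key (ℓ + 1) 1 2 J K h mn m1 m2 n1.symm n2.symm (by omega)
      (Or.inr (Or.inr ⟨by simp, h5, h6⟩))
      (by unfold condE; simp only [Finset.mem_singleton]; tauto) H0
  · rw [reD_symm]
    exact key (ℓ + 1) 1 2 K J (validE_symm h) mn m1 m2 n1.symm n2.symm (by omega)
      (Or.inr (Or.inr ⟨by simp, h5, h6⟩))
      (by unfold condE; simp only [Finset.mem_singleton]; tauto) hsym
  · rw [reD_symm]
    exact key 1 2 (ℓ + 1) K J (validE_symm h) m1 m2 mn (by omega) n1 n2
      (Or.inl ⟨h5, h6, by simp⟩)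
      (by unfold condE; simp only [Finset.mem_singleton]; tauto) hsym

lemma validE_eq_of_subset {ℓ : ℕ} {J K J' K' : Finset ℕ}
    (h : validE (Iset ℓ) J K) (h' : validE (Iset ℓ) J' K') (hJ : J' ⊆ J) (hK : K' ⊆ K) :
    J' = J ∧ K' = K := by
  have key : ∀ w, w ∈ J ∨ w ∈ K → w ∈ J' ∨ w ∈ K' := by
    intro w hw
    rw [← Finset.mem_union, h'.2, ← h.2, Finset.mem_union]
    exact hw
  constructor
  · refine hJ.antisymm fun w hw => (key w (Or.inl hw)).resolve_right fun hk => ?_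
    exact Finset.disjoint_left.1 h.1 hw (hK hk)
  · refine hK.antisymm fun w hw => (key w (Or.inr hw)).resolve_left fun hk => ?_
    exact Finset.disjoint_left.1 h.1 (hJ hk) hw

lemma notMem_of_validE {ℓ : ℕ} {J K : Finset ℕ} (h : validE (Iset ℓ) J K) :
    ℓ + 1 ∉ J ∧ ℓ + 1 ∉ K := by
  have hn : ℓ + 1 ∉ J ∪ K := by rw [h.2]; simp
  rw [Finset.mem_union, not_or] at hn
  exact hn

lemma subset_of_union_single {n : ℕ} {A B : Finset ℕ} (hn : n ∉ A) (h : A ⊆ B ∪ {n}) : A ⊆ B := by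
  intro w hw
  rcases Finset.mem_union.1 (h hw) with g | g
  · exact g
  · rw [Finset.mem_singleton] at g
    exact absurd (g ▸ hw) hn

/-- `f^+ · e^0` for `e ≠ f`. -/
lemma prod_ep_e0_ne (R : Type) [CommRing R] (ℓ : ℕ)
    {J K J' K' : Finset ℕ} (h : validE (Iset ℓ) J K) (h' : validE (Iset ℓ) J' K')
    (h1 : ¬ (J' = J ∧ K' = K)) (h2 : ¬ (J' = K ∧ K' = J)) :
    reE R (Iset (ℓ + 1)) (J ∪ {ℓ + 1}) K * reD R (Iset (ℓ + 1)) {ℓ + 1} J' K' ∈ subM R ℓ := by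
  apply subM_ideal
  apply ED_mem
  obtain ⟨n1, n2⟩ := notMem_of_validE h'
  rintro (⟨a, b⟩ | ⟨a, b⟩)
  · exact h1 (validE_eq_of_subset h h' (subset_of_union_single n1 a) b)
  · exact h2 (validE_eq_of_subset (validE_symm h) h' a (subset_of_union_single n2 b))

lemma prod_ep_e0 (R : Type) [CommRing R] (ℓ : ℕ) (hℓ : 2 ≤ ℓ)
    {J K J' K' : Finset ℕ} (h : validE (Iset ℓ) J K) (h' : validE (Iset ℓ) J' K') :
    reE R (Iset (ℓ + 1)) (J ∪ {ℓ + 1}) K * reD R (Iset (ℓ + 1)) {ℓ + 1} J' K' ∈ subM R ℓ := by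
  have self : reE R (Iset (ℓ + 1)) (J ∪ {ℓ + 1}) K * reD R (Iset (ℓ + 1)) {ℓ + 1} J K
      ∈ subM R ℓ := by
    refine e0_extract R ℓ hℓ _ h ?_ ?_ ?_ ?_
    · exact fun J' K' h' h1 h2 => prod_ep_e0_ne R ℓ h h' h1 h2
    · exact fun I' J' K' h' => prod_ep_d R ℓ hℓ h h'
    · intro i hi
      rw [mul_comm]; exact prod_i0_e R ℓ hℓ i hi h
    · intro i hi
      rw [mul_comm]; exact prod_im_e R ℓ hℓ i hi h
  by_cases h1 : J' = J ∧ K' = K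
  · rw [h1.1, h1.2]; exact self
  by_cases h2 : J' = K ∧ K' = J
  · rw [h2.1, h2.2, reD_symm]; exact self
  exact prod_ep_e0_ne R ℓ h h' h1 h2

/-- `f^0 · e^0` for `e ≠ f`. -/
lemma prod_e0_e0_ne (R : Type) [CommRing R] (ℓ : ℕ) (hℓ : 2 ≤ ℓ)
    {J K J' K' : Finset ℕ} (h : validE (Iset ℓ) J K) (h' : validE (Iset ℓ) J' K')
    (h1 : ¬ (J' = J ∧ K' = K)) (h2 : ¬ (J' = K ∧ K' = J)) :
    reD R (Iset (ℓ + 1)) {ℓ + 1} J K * reD R (Iset (ℓ + 1)) {ℓ + 1} J' K' ∈ subM R ℓ := by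
  apply DDM
  refine ⟨?_, ?_, ?_⟩
  · rintro (⟨a, b⟩ | ⟨a, b⟩)
    · have := validE_eq_of_subset h' h a b
      exact h1 ⟨this.1.symm, this.2.symm⟩
    · have := validE_eq_of_subset (validE_symm h') h a b
      exact h2 ⟨this.2.symm, this.1.symm⟩
  · rintro (⟨a, b⟩ | ⟨a, b⟩)
    · exact h1 (validE_eq_of_subset h h' a b)
    · exact h2 (validE_eq_of_subset (validE_symm h) h' a b)
  · intro hs
    have m : 1 ∈ J ∪ K := by rw [h.2]; simp; omega
    have := hs m
    rw [Finset.mem_singleton] at this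
    omega

lemma prod_e0_e0 (R : Type) [CommRing R] (ℓ : ℕ) (hℓ : 2 ≤ ℓ)
    {J K J' K' : Finset ℕ} (h : validE (Iset ℓ) J K) (h' : validE (Iset ℓ) J' K') :
    reD R (Iset (ℓ + 1)) {ℓ + 1} J K * reD R (Iset (ℓ + 1)) {ℓ + 1} J' K' ∈ subM R ℓ := by
  have self : reD R (Iset (ℓ + 1)) {ℓ + 1} J K * reD R (Iset (ℓ + 1)) {ℓ + 1} J K
      ∈ subM R ℓ := by
    refine e0_extract R ℓ hℓ _ h ?_ ?_ ?_ ?_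
    · exact fun J' K' h' h1 h2 => prod_e0_e0_ne R ℓ hℓ h h' h1 h2
    · exact fun I' J' K' h' => prod_e0_d R ℓ hℓ h h'
    · intro i hi
      rw [mul_comm]; exact prod_i0_e0 R ℓ hℓ i hi h
    · intro i hi
      rw [mul_comm]; exact prod_im_e0 R ℓ hℓ i hi h
  by_cases h1 : J' = J ∧ K' = K
  · rw [h1.1, h1.2]; exact self
  by_cases h2 : J' = K ∧ K' = J
  · rw [h2.1, h2.2, reD_symm R _ _ K J]; exact self
  exact prod_e0_e0_ne R ℓ hℓ h h' h1 h2

/-- The square of `D̃⁰₁`. -/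
lemma prod_s_s (R : Type) [CommRing R] (ℓ : ℕ) (hℓ : 2 ≤ ℓ) :
    reD R (Iset (ℓ + 1)) (Iset ℓ \ {1}) {1, ℓ + 1} ∅ *
      reD R (Iset (ℓ + 1)) (Iset ℓ \ {1}) {1, ℓ + 1} ∅ ∈ subM R ℓ := by
  have m1 : 1 ∈ Iset ℓ := by simp; omega
  have m2 : 2 ∈ Iset ℓ := by simp; omega
  have n1 : ℓ + 1 ≠ 1 := by omega
  have n2 : ℓ + 1 ≠ 2 := by omega
  by_cases v : validD (Iset (ℓ + 1)) (Iset ℓ \ {1}) {1, ℓ + 1} ∅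
  swap
  · rw [reD_invalid _ _ _ _ _ v, mul_zero]; exact zero_mem _
  rw [← mem_subN]
  refine rel_extract R _ (ℓ + 1) 1 2 (subN R ℓ _) (subN_ideal _ (relE_mem R ℓ
      (succ_mem_Iset ℓ) (mem_Iset_succ m1) (mem_Iset_succ m2) n1 n2 (by omega)))
      _ _ _ v (Or.inl ⟨by simp, by simp, by simp [hℓ]⟩) ?_
  intro I' J' K' hv hc hne
  rcases casesD hv with ⟨rfl, h'⟩ | ⟨I₀, rfl, h'⟩ | ⟨J₀, rfl, h'⟩ | ⟨K₀, rfl, h'⟩ |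
      ⟨j, hj, rfl, h'⟩
  · exact prod_i0_e0 R ℓ hℓ 1 m1 h'
  · exact (prod_i0_d R ℓ hℓ 1 m1 h').1
  · exact (prod_i0_d R ℓ hℓ 1 m1 h').2.1
  · exact (prod_i0_d R ℓ hℓ 1 m1 h').2.2
  · have hnj := ne_succ_of_mem hj
    have hJ : j = 2 ∧ J' = {2, ℓ + 1} ∧ K' = ∅ := by
      rcases hc with ⟨c1, c2, c3⟩ | ⟨c1, c2, c3⟩ | ⟨c1, -, -⟩
      · exfalso
        rcases h' with ⟨rfl, rfl⟩ | ⟨rfl, rfl⟩ | ⟨rfl, rfl⟩ | ⟨rfl, rfl⟩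
        · have : j = 1 := by
            simp only [Finset.mem_insert, Finset.mem_singleton] at c2; omega
          subst this
          exact hne ⟨rfl, rfl, rfl⟩
        · simp at c1
        · simp only [Finset.mem_singleton] at c1; omega
        · simp only [Finset.mem_singleton] at c2; omega
      · rcases h' with ⟨rfl, rfl⟩ | ⟨rfl, rfl⟩ | ⟨rfl, rfl⟩ | ⟨rfl, rfl⟩
        · have : j = 2 := by
            simp only [Finset.mem_insert, Finset.mem_singleton] at c2; omega
          subst this
          exact ⟨rfl, rfl, rfl⟩
        · simp at c1
        · simp only [Finset.mem_singleton] at c1; omega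
        · simp only [Finset.mem_singleton] at c2; omega
      · simp at c1
    obtain ⟨rfl, rfl, rfl⟩ := hJ
    rw [mem_subN]
    apply DDM
    refine ⟨?_, ?_, ?_⟩
    · rintro (⟨a, -⟩ | ⟨a, -⟩)
      · have := a (Finset.mem_insert_self _ _)
        simp only [Finset.mem_insert, Finset.mem_singleton] at this; omega
      · have := a (Finset.mem_insert_self _ _)
        simp at this
    · rintro (⟨a, -⟩ | ⟨a, -⟩)
      · have := a (Finset.mem_insert_self _ _)
        simp only [Finset.mem_insert, Finset.mem_singleton] at this; omega
      · have := a (Finset.mem_insert_self _ _)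
        simp at this
    · intro a
      have : ℓ + 1 ∈ Iset ℓ \ {2} := a (by simp)
      simp at this

lemma gen_mul (R : Type) [CommRing R] (ℓ : ℕ) (hℓ : 2 ≤ ℓ) {g g' : RRing R (Iset (ℓ + 1))}
    (hg : GenM R ℓ g) (hg' : GenM R ℓ g') : g * g' ∈ subM R ℓ := by
  have m1 : 1 ∈ Iset ℓ := by simp; omega
  cases hg with
  | one => rw [one_mul]; exact hg'.mem hℓ
  | sec =>
    cases hg' with
    | one => rw [mul_one]; exact subM_s R ℓ
    | sec => exact prod_s_s R ℓ hℓ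
    | e0 J K h => exact prod_i0_e0 R ℓ hℓ 1 m1 h
    | ep J K h => exact prod_i0_e R ℓ hℓ 1 m1 h
    | dI I J K h => exact (prod_i0_d R ℓ hℓ 1 m1 h).1
    | dJ I J K h => exact (prod_i0_d R ℓ hℓ 1 m1 h).2.1
  | e0 J K h =>
    cases hg' with
    | one => rw [mul_one]; exact subM_e0' R ℓ hℓ h
    | sec => rw [mul_comm]; exact prod_i0_e0 R ℓ hℓ 1 m1 h
    | e0 J' K' h' => exact prod_e0_e0 R ℓ hℓ h h'
    | ep J' K' h' => rw [mul_comm]; exact prod_ep_e0 R ℓ hℓ h' h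
    | dI I' J' K' h' => exact (prod_e0_d R ℓ hℓ h h').1
    | dJ I' J' K' h' => exact (prod_e0_d R ℓ hℓ h h').2.1
  | ep J K h =>
    cases hg' with
    | one => rw [mul_one]; exact subM_ep' R ℓ hℓ h
    | sec => rw [mul_comm]; exact prod_i0_e R ℓ hℓ 1 m1 h
    | e0 J' K' h' => exact prod_ep_e0 R ℓ hℓ h h'
    | ep J' K' h' => exact subM_ideal _ _ (EE_mem _ _ _ _ _ _)
    | dI I' J' K' h' => exact (prod_ep_d R ℓ hℓ h h').1
    | dJ I' J' K' h' => exact (prod_ep_d R ℓ hℓ h h').2.1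
  | dI I J K h =>
    cases hg' with
    | one => rw [mul_one]; exact (subM_d' R ℓ h).1
    | sec => rw [mul_comm]; exact (prod_i0_d R ℓ hℓ 1 m1 h).1
    | e0 J' K' h' => rw [mul_comm]; exact (prod_e0_d R ℓ hℓ h' h).1
    | ep J' K' h' => rw [mul_comm]; exact (prod_ep_d R ℓ hℓ h' h).1
    | dI I' J' K' h' => exact (prod_dd R ℓ hℓ h h').1.1
    | dJ I' J' K' h' => exact (prod_dd R ℓ hℓ h h').1.2.1
  | dJ I J K h =>
    cases hg' with
    | one => rw [mul_one]; exact (subM_d' R ℓ h).2.1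
    | sec => rw [mul_comm]; exact (prod_i0_d R ℓ hℓ 1 m1 h).2.1
    | e0 J' K' h' => rw [mul_comm]; exact (prod_e0_d R ℓ hℓ h' h).2.1
    | ep J' K' h' => rw [mul_comm]; exact (prod_ep_d R ℓ hℓ h' h).2.1
    | dI I' J' K' h' => exact (prod_dd R ℓ hℓ h h').2.1
    | dJ I' J' K' h' => exact (prod_dd R ℓ hℓ h h').2.2.1

lemma subM_mul (R : Type) [CommRing R] (ℓ : ℕ) (hℓ : 2 ≤ ℓ) {p q : RRing R (Iset (ℓ + 1))}
    (hp : p ∈ subM R ℓ) (hq : q ∈ subM R ℓ) : p * q ∈ subM R ℓ := by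
  rw [← mem_subN]
  refine subM_ind (subN R ℓ p) (fun x hx => subN_ideal _ hx) ?_ hq
  intro g hg x
  rw [mem_subN, mul_comm, ← mem_subN]
  refine subM_ind (subN R ℓ _) (fun x hx => subN_ideal _ hx) ?_ hp
  intro g' hg' y
  rw [mem_subN]
  have e : g * Fre R ℓ x * (g' * Fre R ℓ y) = g * g' * Fre R ℓ (x * y) := by
    rw [map_mul]; ring
  rw [e]
  exact subM_mulF R ℓ _ (gen_mul R ℓ hℓ hg hg')

lemma reD_mem (R : Type) [CommRing R] (ℓ : ℕ) (hℓ : 2 ≤ ℓ) (I J K : Finset ℕ) :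
    reD R (Iset (ℓ + 1)) I J K ∈ subM R ℓ := by
  by_cases v : validD (Iset (ℓ + 1)) I J K
  swap
  · rw [reD_invalid _ _ _ _ _ v]; exact zero_mem _
  rcases casesD v with ⟨rfl, h'⟩ | ⟨I₀, rfl, h'⟩ | ⟨J₀, rfl, h'⟩ | ⟨K₀, rfl, h'⟩ |
      ⟨j, hj, rfl, h'⟩
  · exact subM_e0' R ℓ hℓ h'
  · exact (subM_d' R ℓ h').1
  · exact (subM_d' R ℓ h').2.1
  · exact (subM_d' R ℓ h').2.2
  · exact special_mem _ (D_i0_mem R ℓ hℓ j hj) (D_im_mem R ℓ hℓ j hj) h'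

lemma reE_mem_aux (R : Type) [CommRing R] (ℓ : ℕ) (hℓ : 2 ≤ ℓ) (J K : Finset ℕ)
    (v : validE (Iset (ℓ + 1)) J K) (hn : ℓ + 1 ∈ J) :
    reE R (Iset (ℓ + 1)) J K ∈ subM R ℓ := by
  have e : J = J.erase (ℓ + 1) ∪ {ℓ + 1} := by
    ext w
    simp only [Finset.mem_union, Finset.mem_erase, Finset.mem_singleton]
    by_cases hw : w = ℓ + 1
    · subst hw; simp [hn]
    · simp [hw]
  have hE : validE (Iset ℓ) (J.erase (ℓ + 1)) K := by
    refine ⟨Finset.disjoint_of_subset_left (Finset.erase_subset _ _) v.1, ?_⟩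
    have hk : ℓ + 1 ∉ K := Finset.disjoint_left.1 v.1 hn
    ext w
    have hw : w ∈ J ∪ K ↔ w ∈ Iset (ℓ + 1) := by rw [v.2]
    rw [Finset.mem_union] at hw
    rw [Finset.mem_union, Finset.mem_erase]
    by_cases hwn : w = ℓ + 1
    · subst hwn; simp [hk]
    · simp only [ne_eq, hwn, not_false_eq_true, true_and, hw, Finset.mem_Icc]
      omega
  rw [e]
  exact subM_ep' R ℓ hℓ hE

lemma reE_mem (R : Type) [CommRing R] (ℓ : ℕ) (hℓ : 2 ≤ ℓ) (J K : Finset ℕ) :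
    reE R (Iset (ℓ + 1)) J K ∈ subM R ℓ := by
  by_cases v : validE (Iset (ℓ + 1)) J K
  swap
  · rw [reE_invalid _ _ _ _ v]; exact zero_mem _
  have hn : ℓ + 1 ∈ J ∪ K := by rw [v.2]; simp
  rcases Finset.mem_union.1 hn with hn | hn
  · exact reE_mem_aux R ℓ hℓ J K v hn
  · rw [reE_symm]
    exact reE_mem_aux R ℓ hℓ K J (validE_symm v) hn

lemma X_mem (R : Type) [CommRing R] (ℓ : ℕ) (hℓ : 2 ≤ ℓ)
    (ix : EIdx (Iset (ℓ + 1)) ⊕ DIdx (Iset (ℓ + 1))) :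
    (X ix : RRing R (Iset (ℓ + 1))) ∈ subM R ℓ := by
  rcases ix with ⟨J, h⟩ | ⟨⟨I, J⟩, h⟩
  · have e : reE R (Iset (ℓ + 1)) J (Iset (ℓ + 1) \ J) = X (Sum.inl ⟨J, h⟩) := by
      have hm : J.min ≤ (Iset (ℓ + 1) \ J).min := by
        rw [h.2]; exact Finset.min_mono Finset.sdiff_subset
      unfold reE
      rw [if_pos ⟨Finset.disjoint_sdiff, Finset.union_sdiff_of_subset h.1⟩, if_pos hm]
      unfold reXe
      rw [dif_pos h]
    rw [← e]
    exact reE_mem R ℓ hℓ _ _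
  · have e : reD R (Iset (ℓ + 1)) I J ((Iset (ℓ + 1) \ I) \ J) = X (Sum.inr ⟨(I, J), h⟩) := by
      have h2 : J ⊆ Iset (ℓ + 1) \ I := h.2.1
      have hm : J.min ≤ ((Iset (ℓ + 1) \ I) \ J).min := by
        have h5 : J.min = (Iset (ℓ + 1) \ I).min := h.2.2.2.2
        rw [h5]; exact Finset.min_mono Finset.sdiff_subset
      unfold reD
      rw [if_pos ⟨by rw [Finset.union_sdiff_of_subset h2]; exact Finset.disjoint_sdiff,
        Finset.disjoint_sdiff, by
          rw [Finset.union_sdiff_of_subset h2]; exact Finset.union_sdiff_of_subset h.1⟩,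
        if_pos hm]
      unfold reXd
      rw [dif_pos h]
    rw [← e]
    exact reD_mem R ℓ hℓ _ _ _

lemma all_mem (R : Type) [CommRing R] (ℓ : ℕ) (hℓ : 2 ≤ ℓ) (p : RRing R (Iset (ℓ + 1))) :
    p ∈ subM R ℓ := by
  induction p using MvPolynomial.induction_on with
  | C r =>
    have e : Fre R ℓ (C r) = C r := by
      rw [Fre, aeval_C]; rfl
    rw [← e]; exact subM_F R ℓ _
  | add p q hp hq => exact add_mem hp hq
  | mul_X p i hp => exact subM_mul R ℓ hℓ hp (X_mem R ℓ hℓ i)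

/-- `R_{0,[ℓ+1]}` equals the sum of `I_{0,[ℓ+1]}` and the `(Im F)`-submodule
generated by `1`, `D̃⁰₁`, the elements `ℝẼ⁰_{J,K}`, `ℝẼ⁻_{J,K}`, `ℝD̃⁰_{I;J,K}`, `ℝD̃⁻_{I;J,K}`. -/
theorem stmt15 (R : Type) [CommRing R] (ℓ : ℕ) (hℓ : 2 ≤ ℓ) :
    ∀ p : RRing R (Iset (ℓ + 1)),
      ∃ (a a₀ : RRing R (Iset ℓ)) (bE cE : Finset ℕ → RRing R (Iset ℓ))
        (bD cD : Finset ℕ → Finset ℕ → RRing R (Iset ℓ)),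
        p - (Fre R ℓ a +
          reD R (Iset (ℓ + 1)) (Iset ℓ \ {1}) {1, ℓ + 1} ∅ * Fre R ℓ a₀ +
          (∑ J ∈ (Iset ℓ).powerset.filter (fun J => 1 ∈ J),
            (reEt0 R ℓ J (Iset ℓ \ J) * Fre R ℓ (bE J) +
             reEtm R ℓ J (Iset ℓ \ J) * Fre R ℓ (cE J))) +
          ∑ I ∈ (Iset ℓ).powerset.filter (fun I => 1 ≤ I.card ∧ 2 ≤ (Iset ℓ \ I).card),
            ∑ J ∈ (Iset ℓ \ I).powerset.filter (fun J => J.min = (Iset ℓ \ I).min),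
              (reDt0 R ℓ I J ((Iset ℓ \ I) \ J) * Fre R ℓ (bD I J) +
               reDtm R ℓ I J ((Iset ℓ \ I) \ J) * Fre R ℓ (cD I J))) ∈
          reIdeal R (Iset (ℓ + 1)) := by
  intro p
  obtain ⟨a, a₀, bE, cE, bD, cD, h⟩ := all_mem R ℓ hℓ p
  exact ⟨a, a₀, bE, cE, bD, cD, h⟩

end
end
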